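/- arXiv:1301.1512 — 4 statements merged into one kernel-verified Lean document; each statement's English description precedes it below -/
import Mathlib

section
/- Every 2-connected P_3-f_1-heavy graph is pancyclic. That is, if G is a 2-connected graph on n ≥ 3 vertices such that for every induced path u-w-v on three vertices in G one has max{d(u), d(v)} ≥ (n+1)/2, then G contains cycles of every length from 3 to n. -/
open SimpleGraph

/-- `G` contains a cycle of length `k`. -/
def HasCycleLength {V : Type} (G : SimpleGraph V) (k : ℕ) : Prop :=
  ∃ (v : V) (c : G.Walk v v), c.IsCycle ∧ c.length = k

/-- A graph on `n` vertices is pancyclic if it contains cycles of every length from 3 to `n`. -/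
def IsPancyclic {V : Type} [Fintype V] (G : SimpleGraph V) : Prop :=
  ∀ k : ℕ, 3 ≤ k → k ≤ Fintype.card V → HasCycleLength G k

/-- A graph is Hamiltonian if it contains a spanning cycle. -/
def IsHamiltonianGraph {V : Type} (G : SimpleGraph V) : Prop :=
  ∃ (v : V) (c : G.Walk v v), c.IsCycle ∧ ∀ u : V, u ∈ c.support

/-- A graph is 2-connected if it has at least 3 vertices and deleting any single
vertex leaves a connected graph. -/
def TwoConnected {V : Type} [Fintype V] (G : SimpleGraph V) : Prop :=
  3 ≤ Fintype.card V ∧ ∀ v : V, (G.induce {u : V | u ≠ v}).Connected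

/-- A (finite) graph is a cycle iff it is connected and 2-regular. -/
def IsCycleGraph {V : Type} [Fintype V] (G : SimpleGraph V) [DecidableRel G.Adj] : Prop :=
  G.Connected ∧ ∀ v : V, G.degree v = 2

/-- `G` is `R`-f₁-heavy: for every induced copy of `R` in `G` (given by a graph
embedding `f : R ↪g G`) and every pair of vertices at distance 2 in that copy,
one of them has degree at least `(n+1)/2` in `G`. -/
def F1Heavy {V W : Type} [Fintype V] (G : SimpleGraph V) [DecidableRel G.Adj]
    (R : SimpleGraph W) : Prop :=
  ∀ (f : R ↪g G) (a b : W), R.dist a b = 2 →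
    Fintype.card V + 1 ≤ 2 * max (G.degree (f a)) (G.degree (f b))

/-- `G` is `R`-f-heavy: as above but with degree at least `n/2`. -/
def FHeavy {V W : Type} [Fintype V] (G : SimpleGraph V) [DecidableRel G.Adj]
    (R : SimpleGraph W) : Prop :=
  ∀ (f : R ↪g G) (a b : W), R.dist a b = 2 →
    Fintype.card V ≤ 2 * max (G.degree (f a)) (G.degree (f b))

/-- `G` is `R`-free: no induced subgraph of `G` is isomorphic to `R`. -/
def RFree {V W : Type} (G : SimpleGraph V) (R : SimpleGraph W) : Prop :=
  IsEmpty (R ↪g G)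

/-- The claw `K_{1,3}`: vertex `0` is the center, adjacent to `1`, `2`, `3`. -/
def claw : SimpleGraph (Fin 4) := SimpleGraph.fromRel (fun a _ => a = 0)

/-- `Z_i`: the path `0 1 2 ... (i+2)` together with the chord `{0,2}`,
i.e. a triangle `0 1 2` with a path of `i` edges attached at vertex `2`. -/
def Zgraph (i : ℕ) : SimpleGraph (Fin (i + 3)) :=
  SimpleGraph.fromRel (fun a b => b.val = a.val + 1 ∨ (a.val = 0 ∧ b.val = 2))

/-- The net `N`: triangle `0 1 2` with pendant edges `0-3`, `1-4`, `2-5`. -/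
def netGraph : SimpleGraph (Fin 6) :=
  SimpleGraph.fromRel (fun a b =>
    (a.val = 0 ∧ b.val = 1) ∨ (a.val = 1 ∧ b.val = 2) ∨ (a.val = 0 ∧ b.val = 2) ∨
    (a.val = 0 ∧ b.val = 3) ∨ (a.val = 1 ∧ b.val = 4) ∨ (a.val = 2 ∧ b.val = 5))

/-- The wounded `W`: triangle `0 1 2` with a pendant edge `0-3` and a pendant
path `1-4-5` of two edges. -/
def woundedGraph : SimpleGraph (Fin 6) :=
  SimpleGraph.fromRel (fun a b =>
    (a.val = 0 ∧ b.val = 1) ∨ (a.val = 1 ∧ b.val = 2) ∨ (a.val = 0 ∧ b.val = 2) ∨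
    (a.val = 0 ∧ b.val = 3) ∨ (a.val = 1 ∧ b.val = 4) ∨ (a.val = 4 ∧ b.val = 5))


/-- `p 0, …, p (k-1)` is a path. -/
def IdxPath {V : Type} (G : SimpleGraph V) (k : ℕ) (p : ℕ → V) : Prop :=
  (∀ i j, i < k → j < k → p i = p j → i = j) ∧ (∀ i, i + 1 < k → G.Adj (p i) (p (i + 1)))

/-- `p 0, …, p (k-1)` is a cycle. -/
def IdxCycle {V : Type} (G : SimpleGraph V) (k : ℕ) (p : ℕ → V) : Prop :=
  IdxPath G k p ∧ G.Adj (p (k - 1)) (p 0)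

lemma IdxPath.walk {V : Type} {G : SimpleGraph V} (p : ℕ → V) (m : ℕ)
    (h : ∀ i, i < m → G.Adj (p i) (p (i + 1))) :
    ∃ w : G.Walk (p 0) (p m), w.support = (List.range (m + 1)).map p := by
  induction m with
  | zero => exact ⟨Walk.nil, by simp⟩
  | succ m ih =>
    obtain ⟨w, hw⟩ := ih (fun i hi => h i (by omega))
    refine ⟨w.concat (h m (by omega)), ?_⟩
    rw [Walk.support_concat, hw, List.range_succ (n := m + 1)]
    simp

lemma IdxCycle.hasCycle {V : Type} {G : SimpleGraph V} {k : ℕ} {p : ℕ → V} (hk : 3 ≤ k)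
    (h : IdxCycle G k p) : HasCycleLength G k := by
  obtain ⟨⟨hi, ha⟩, hc⟩ := h
  obtain ⟨m, rfl⟩ : ∃ m, k = m + 1 := ⟨k - 1, by omega⟩
  obtain ⟨w, hw⟩ := IdxPath.walk (G := G) p m (fun i h => ha i (by omega))
  have hp : w.IsPath := by
    rw [Walk.isPath_def, hw]
    refine List.Nodup.map_on ?_ List.nodup_range
    intro x hx y hy hxy
    exact hi x y (by simpa using hx) (by simpa using hy) hxy
  have hl : w.length = m := by
    have := congrArg List.length hw
    simpa using this
  simp only [Nat.add_sub_cancel] at hc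
  refine ⟨p m, Walk.cons hc w, ?_, by simp [hl]⟩
  rw [Walk.cons_isCycle_iff]
  refine ⟨hp, fun he => ?_⟩
  rw [Sym2.eq_swap] at he
  have := hp.length_eq_one_of_mem_edges he
  omega

lemma IdxCycle.rotate {V : Type} {G : SimpleGraph V} {k : ℕ} {p : ℕ → V}
    (h : IdxCycle G k p) (i : ℕ) (hi : i + 1 < k) :
    ∃ q, IdxCycle G k q ∧ q (k - 1) = p i ∧ q 0 = p (i + 1) := by
  obtain ⟨⟨h1, h2⟩, h3⟩ := h
  refine ⟨fun j => if j + i + 1 < k then p (j + i + 1) else p (j + i + 1 - k), ⟨⟨?_, ?_⟩, ?_⟩, ?_, ?_⟩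
  · intro a b ha hb hab
    dsimp only at hab
    split_ifs at hab
    all_goals
      have := h1 _ _ (by omega) (by omega) hab
      omega
  · intro a ha
    dsimp only
    split_ifs with h4 h5 h5
    · have := h2 (a + i + 1) (by omega)
      rwa [show a + i + 1 + 1 = a + 1 + i + 1 by omega] at this
    · rwa [show a + i + 1 = k - 1 by omega, show a + 1 + i + 1 - k = 0 by omega]
    · omega
    · have := h2 (a + i + 1 - k) (by omega)
      rwa [show a + i + 1 - k + 1 = a + 1 + i + 1 - k by omega] at this
  · dsimp only
    rw [if_neg (by omega), if_pos (by omega)]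
    have := h2 i hi
    rwa [show k - 1 + i + 1 - k = i by omega, show 0 + i + 1 = i + 1 by omega]
  · dsimp only
    rw [if_neg (by omega)]
    congr 1; omega
  · dsimp only
    rw [if_pos (by omega)]
    congr 1; omega

lemma IdxPath.jump {V : Type} {G : SimpleGraph V} {n : ℕ} {p : ℕ → V} (h : IdxPath G n p)
    (a b : ℕ) (hab : a < b) (hb : b < n) (h1 : G.Adj (p (n - 1)) (p a)) (h2 : G.Adj (p 0) (p b)) :
    ∃ q, IdxCycle G (a + 1 + n - b) q := by
  obtain ⟨hi, ha⟩ := h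
  refine ⟨fun i => if i ≤ a then p i else p (n + a - i), ⟨?_, ?_⟩, ?_⟩
  · intro x y hx hy hxy
    dsimp only at hxy
    split_ifs at hxy
    all_goals
      have := hi _ _ (by omega) (by omega) hxy
      omega
  · intro x hx
    dsimp only
    split_ifs
    · exact ha x (by omega)
    · rw [show x = a by omega, show n + a - (a + 1) = n - 1 by omega]
      exact h1.symm
    · omega
    · have := (ha (n + a - (x + 1)) (by omega)).symm
      rwa [show n + a - (x + 1) + 1 = n + a - x by omega] at this
  · dsimp only
    rw [if_neg (by omega), if_pos (by omega), show n + a - (a + 1 + n - b - 1) = b by omega]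
    exact h2.symm

lemma IdxCycle.short {V : Type} {G : SimpleGraph V} {n : ℕ} {p : ℕ → V} (h : IdxCycle G n p)
    (a k : ℕ) (ha0 : 1 ≤ a) (hk : 3 ≤ k) (hb : a + (k - 3) < n - 1)
    (h1 : G.Adj (p (n - 1)) (p (a + (k - 3)))) (h2 : G.Adj (p 0) (p a)) :
    ∃ q, IdxCycle G k q := by
  obtain ⟨⟨hi, ha⟩, hc⟩ := h
  refine ⟨fun i => if i < k - 2 then p (a + i) else if i = k - 2 then p (n - 1) else p 0,
    ⟨?_, ?_⟩, ?_⟩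
  · intro x y hx hy hxy
    dsimp only at hxy
    split_ifs at hxy
    all_goals
      first
      | omega
      | (have := hi _ _ (by omega) (by omega) hxy
         omega)
  · intro x hx
    dsimp only
    split_ifs
    all_goals try omega
    · exact ha (a + x) (by omega)
    · rw [show x = k - 3 by omega]; exact h1.symm
  · dsimp only
    rw [if_neg (by omega), if_neg (by omega), if_pos (by omega)]
    exact h2

lemma idx_surj {V : Type} [Fintype V] {p : ℕ → V}
    (h : ∀ i j, i < Fintype.card V → j < Fintype.card V → p i = p j → i = j) (v : V) :
    ∃ i < Fintype.card V, p i = v := by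
  classical
  have : (Finset.range (Fintype.card V)).image p = Finset.univ := by
    apply Finset.eq_univ_of_card
    rw [Finset.card_image_of_injOn, Finset.card_range]
    intro x hx y hy hxy
    exact h x y (by simpa using hx) (by simpa using hy) hxy
  have hv : v ∈ (Finset.range (Fintype.card V)).image p := by rw [this]; simp
  simpa using hv

lemma idx_degree {V : Type} [Fintype V] (G : SimpleGraph V) [DecidableRel G.Adj] {p : ℕ → V}
    (h : ∀ i j, i < Fintype.card V → j < Fintype.card V → p i = p j → i = j) (v : V) :
    ((Finset.range (Fintype.card V)).filter (fun i => G.Adj v (p i))).card = G.degree v := by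
  classical
  rw [← G.card_neighborFinset_eq_degree]
  refine Finset.card_bij (fun i _ => p i) ?_ ?_ ?_
  · intro a ha; simpa using (Finset.mem_filter.1 ha).2
  · intro a ha b hb hab
    simp only [Finset.mem_filter, Finset.mem_range] at ha hb
    exact h a b ha.1 hb.1 hab
  · intro b hb
    obtain ⟨i, hi, rfl⟩ := idx_surj h b
    exact ⟨i, by simpa [hi] using hb, rfl⟩

/-- Bondy's argument. -/
lemma bondy {V : Type} [Fintype V] (G : SimpleGraph V) [DecidableRel G.Adj] {p : ℕ → V}
    (h : IdxCycle G (Fintype.card V) p)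
    (hd : Fintype.card V + 1 ≤ G.degree (p 0) + G.degree (p (Fintype.card V - 1))) :
    IsPancyclic G := by
  classical
  intro k hk hkn
  have hA := idx_degree G h.1.1 (p 0)
  have hB := idx_degree G h.1.1 (p (Fintype.card V - 1))
  set n := Fintype.card V with hn
  set A := (Finset.range n).filter (fun i => G.Adj (p 0) (p i))
  set B := (Finset.range n).filter (fun i => G.Adj (p (n - 1)) (p i))
  have hA0 : ∀ x ∈ A.erase (n - 1), 1 ≤ x ∧ x < n - 1 ∧ G.Adj (p 0) (p x) := by
    intro x hx
    simp only [A, Finset.mem_erase, Finset.mem_filter, Finset.mem_range] at hx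
    refine ⟨?_, by omega, hx.2.2⟩
    rcases Nat.eq_zero_or_pos x with rfl | h0
    · exact absurd hx.2.2 (G.irrefl)
    · exact h0
  have hB0 : ∀ x ∈ B.erase 0, 1 ≤ x ∧ x < n - 1 ∧ G.Adj (p (n - 1)) (p x) := by
    intro x hx
    simp only [B, Finset.mem_erase, Finset.mem_filter, Finset.mem_range] at hx
    refine ⟨by omega, ?_, hx.2.2⟩
    rcases Nat.lt_or_ge x (n - 1) with h0 | h0
    · exact h0
    · have : x = n - 1 := by omega
      subst this
      exact absurd hx.2.2 (G.irrefl)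
  have hAc : G.degree (p 0) - 1 ≤ (A.erase (n - 1)).card := by
    rw [← hA]; exact Finset.pred_card_le_card_erase
  have hBc : G.degree (p (n - 1)) - 1 ≤ (B.erase 0).card := by
    rw [← hB]; exact Finset.pred_card_le_card_erase
  let φ : ℕ → ℕ := fun j => if j + (k - 3) < n - 1 then j + (k - 3) else j + k - n - 1
  have hφ : ((A.erase (n - 1)).image φ).card = (A.erase (n - 1)).card := by
    apply Finset.card_image_of_injOn
    intro x hx y hy hxy
    have hx := hA0 x hx
    have hy := hA0 y hy
    simp only [φ] at hxy
    split_ifs at hxy <;> omega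
  have hnd : ¬ Disjoint ((A.erase (n - 1)).image φ) (B.erase 0) := by
    intro hdis
    have h1 := Finset.card_union_of_disjoint hdis
    have h2 : ((A.erase (n - 1)).image φ ∪ (B.erase 0)) ⊆ Finset.Ico 1 (n - 1) := by
      intro x hx
      rw [Finset.mem_union, Finset.mem_image] at hx
      rw [Finset.mem_Ico]
      rcases hx with ⟨y, hy, rfl⟩ | hx
      · have := hA0 y hy
        simp only [φ]
        split_ifs <;> omega
      · have := hB0 x hx
        omega
    have h3 := Finset.card_le_card h2
    rw [Nat.card_Ico] at h3
    omega
  rw [Finset.not_disjoint_iff] at hnd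
  obtain ⟨x, hx, hxB⟩ := hnd
  obtain ⟨y, hy, rfl⟩ := Finset.mem_image.1 hx
  have hy := hA0 y hy
  have hxB := hB0 _ hxB
  simp only [φ] at hxB
  split_ifs at hxB with hc
  · obtain ⟨q, hq⟩ := h.short y k hy.1 hk hc hxB.2.2 hy.2.2
    exact hq.hasCycle hk
  · obtain ⟨q, hq⟩ := h.1.jump (y + k - n - 1) y (by omega) (by omega) hxB.2.2 hy.2.2
    rw [show y + k - n - 1 + 1 + n - y = k by omega] at hq
    exact hq.hasCycle hk

lemma crossing {V : Type} [Fintype V] (G : SimpleGraph V) [DecidableRel G.Adj] {p : ℕ → V}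
    (h : IdxPath G (Fintype.card V) p) (h3 : 3 ≤ Fintype.card V)
    (hd : Fintype.card V ≤ G.degree (p 0) + G.degree (p (Fintype.card V - 1))) :
    ∃ q, IdxCycle G (Fintype.card V) q := by
  classical
  have hA := idx_degree G h.1 (p 0)
  have hB := idx_degree G h.1 (p (Fintype.card V - 1))
  set n := Fintype.card V with hn
  set A := (Finset.range n).filter (fun i => G.Adj (p 0) (p i))
  set B := (Finset.range n).filter (fun i => G.Adj (p (n - 1)) (p i))
  have hA0 : ∀ x ∈ A, 1 ≤ x ∧ x < n ∧ G.Adj (p 0) (p x) := by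
    intro x hx
    simp only [A, Finset.mem_filter, Finset.mem_range] at hx
    refine ⟨?_, by omega, hx.2⟩
    rcases Nat.eq_zero_or_pos x with rfl | h0
    · exact absurd hx.2 (G.irrefl)
    · exact h0
  have hB0 : ∀ x ∈ B, x < n - 1 ∧ G.Adj (p (n - 1)) (p x) := by
    intro x hx
    simp only [B, Finset.mem_filter, Finset.mem_range] at hx
    refine ⟨?_, hx.2⟩
    rcases Nat.lt_or_ge x (n - 1) with h0 | h0
    · exact h0
    · have : x = n - 1 := by omega
      subst this
      exact absurd hx.2 (G.irrefl)
  have hφ : (A.image (fun j => j - 1)).card = A.card := by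
    apply Finset.card_image_of_injOn
    intro x hx y hy hxy
    have hx := hA0 x hx
    have hy := hA0 y hy
    dsimp only at hxy
    omega
  have hnd : ¬ Disjoint (A.image (fun j => j - 1)) B := by
    intro hdis
    have h1 := Finset.card_union_of_disjoint hdis
    have h2 : (A.image (fun j => j - 1) ∪ B) ⊆ Finset.range (n - 1) := by
      intro x hx
      rw [Finset.mem_union, Finset.mem_image] at hx
      rw [Finset.mem_range]
      rcases hx with ⟨y, hy, rfl⟩ | hx
      · have := hA0 y hy
        omega
      · exact (hB0 x hx).1
    have h3 := Finset.card_le_card h2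
    rw [Finset.card_range] at h3
    omega
  rw [Finset.not_disjoint_iff] at hnd
  obtain ⟨x, hx, hxB⟩ := hnd
  obtain ⟨y, hy, rfl⟩ := Finset.mem_image.1 hx
  have hy := hA0 y hy
  have hxB := hB0 _ hxB
  obtain ⟨q, hq⟩ := h.jump (y - 1) y (by omega) (by omega) hxB.2 hy.2.2
  rw [show y - 1 + 1 + n - y = n by omega] at hq
  exact ⟨q, hq⟩

lemma order_list {V : Type} [DecidableEq V] (K : Finset V) (x y : V) (hx : x ∈ K) (hy : y ∈ K)
    (h : x ≠ y ∨ ∀ z ∈ K, z = x) :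
    ∃ P : List V, P.Nodup ∧ (∀ z, z ∈ P ↔ z ∈ K) ∧ P.head? = some x ∧ P.getLast? = some y := by
  by_cases hxy : x = y
  · subst hxy
    have h : ∀ z ∈ K, z = x := by
      rcases h with h | h
      · exact absurd rfl h
      · exact h
    refine ⟨[x], by simp, ?_, rfl, rfl⟩
    intro z
    simp only [List.mem_singleton]
    exact ⟨fun h => h ▸ hx, h z⟩
  · refine ⟨x :: (((K.erase x).erase y).toList ++ [y]), ?_, ?_, rfl, ?_⟩
    · rw [List.nodup_cons, List.nodup_append]
      refine ⟨?_, Finset.nodup_toList _, by simp, ?_⟩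
      · simp [hxy]
      · intro a ha b hb
        simp only [List.mem_singleton] at hb
        subst hb
        rintro rfl
        simp at ha
    · intro z
      simp only [List.mem_cons, List.mem_append, Finset.mem_toList, Finset.mem_erase,
        List.not_mem_nil, or_false]
      constructor
      · rintro (rfl | h | rfl)
        · exact hx
        · exact h.2.2
        · exact hy
      · intro hz
        by_cases h1 : z = x
        · exact Or.inl h1
        · by_cases h2 : z = y
          · exact Or.inr (Or.inr h2)
          · exact Or.inr (Or.inl ⟨h2, h1, hz⟩)
    · rw [← List.cons_append, List.getLast?_append]; simp

lemma cut_edge {V : Type} [Fintype V] {G : SimpleGraph V} (h2 : TwoConnected G) (z : V)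
    (S : Set V) (s t : V) (hs : s ∈ S) (ht : t ∉ S) (hsz : s ≠ z) (htz : t ≠ z) :
    ∃ x ∈ S, ∃ y, y ∉ S ∧ x ≠ z ∧ y ≠ z ∧ G.Adj x y := by
  obtain ⟨w⟩ := (h2.2 z).preconnected ⟨s, hsz⟩ ⟨t, htz⟩
  obtain ⟨d, -, hd1, hd2⟩ := w.exists_boundary_dart (Subtype.val ⁻¹' S) hs ht
  exact ⟨d.fst, hd1, d.snd, hd2, d.fst.2, d.snd.2, d.adj⟩

section light
variable {V : Type} [Fintype V] {G : SimpleGraph V} [DecidableRel G.Adj] {H : V → Prop}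

lemma full_degree (v : V) (h : ∀ x, x ≠ v → G.Adj v x) : G.degree v + 1 = Fintype.card V := by
  classical
  have : G.neighborFinset v = Finset.univ.erase v := by
    ext x
    simp only [mem_neighborFinset, Finset.mem_erase, Finset.mem_univ, and_true]
    exact ⟨fun h => h.ne', h x⟩
  rw [← G.card_neighborFinset_eq_degree, this, Finset.card_erase_of_mem (Finset.mem_univ _),
    Finset.card_univ]
  have : 0 < Fintype.card V := Fintype.card_pos_iff.2 ⟨v⟩
  omega

lemma block (h2 : TwoConnected G)
    (hH : ∀ v, H v ↔ Fintype.card V + 1 ≤ 2 * G.degree v)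
    (hl : ∀ u w v : V, G.Adj u w → G.Adj w v → u ≠ v → ¬ H u → ¬ H v → G.Adj u v)
    (v : V) (hv : ¬ H v) :
    ∃ B : List V, B.Nodup ∧ B.IsChain (fun x y => G.Adj x y ∨ (H x ∧ H y)) ∧
      (∀ x ∈ B.head?, H x) ∧ (∀ x ∈ B.getLast?, H x) ∧
      (∀ x ∈ B, ¬ H x → x = v ∨ G.Adj v x) ∧ (∀ x, ¬ H x → (x = v ∨ G.Adj v x) → x ∈ B) ∧
      (∀ x ∈ B, H x → ∃ y, ¬ H y ∧ (y = v ∨ G.Adj v y) ∧ G.Adj y x) := by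
  classical
  have h3 := h2.1
  let K : Finset V := Finset.univ.filter (fun x => ¬ H x ∧ (x = v ∨ G.Adj v x))
  have hK : ∀ x, x ∈ K ↔ ¬ H x ∧ (x = v ∨ G.Adj v x) := by intro x; simp [K]
  have hvK : v ∈ K := by rw [hK]; exact ⟨hv, Or.inl rfl⟩
  have hcl : ∀ x ∈ K, ∀ y ∈ K, x ≠ y → G.Adj x y := by
    intro x hx y hy hxy
    rw [hK] at hx hy
    obtain ⟨hx1, rfl | hx2⟩ := hx
    · obtain ⟨hy1, rfl | hy2⟩ := hy
      · exact absurd rfl hxy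
      · exact hy2
    · obtain ⟨hy1, rfl | hy2⟩ := hy
      · exact hx2.symm
      · exact hl x v y hx2.symm hy2 hxy hx1 hy1
  have hout : ∀ x ∈ K, ∀ y, y ∉ K → G.Adj x y → H y := by
    intro x hx y hy hxy
    by_contra hyH
    apply hy
    rw [hK] at hx ⊢
    refine ⟨hyH, ?_⟩
    obtain ⟨hx1, rfl | hx2⟩ := hx
    · exact Or.inr hxy
    · by_cases hyv : y = v
      · exact Or.inl hyv
      · exact Or.inr (hl v x y hx2 hxy (Ne.symm hyv) hv hyH)
  have hnf : ∀ x ∈ K, ∃ y, y ≠ x ∧ ¬ G.Adj x y := by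
    intro x hx
    by_contra! hcon
    have := full_degree x hcon
    have hxH := ((hK x).1 hx).1
    rw [hH] at hxH
    omega
  obtain ⟨t, htv, hvt⟩ := hnf v hvK
  have htK : t ∉ K := fun h => hvt (hcl v hvK t h htv.symm)
  obtain ⟨z, hz⟩ : ∃ z, z ∉ ({v, t} : Finset V) := by
    by_contra! hcon
    have h4 : Finset.univ ⊆ ({v, t} : Finset V) := fun z _ => hcon z
    have h5 := Finset.card_le_card h4
    have h6 : ({v, t} : Finset V).card ≤ 2 := Finset.card_le_two
    rw [Finset.card_univ] at h5
    omega
  simp only [Finset.mem_insert, Finset.mem_singleton, not_or] at hz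
  obtain ⟨x, hx, a, ha, -, -, hxa⟩ := cut_edge h2 z (K : Set V) v t hvK htK (Ne.symm hz.1)
    (Ne.symm hz.2)
  obtain ⟨t', ht'x, ht'⟩ := hnf x hx
  have ht'K : t' ∉ K := fun h => ht' (hcl x hx t' h ht'x.symm)
  have ht'a : t' ≠ a := by rintro rfl; exact ht' hxa
  have hxa' : x ≠ a := hxa.ne
  obtain ⟨x', hx', b, hb, -, hba, hxb⟩ := cut_edge h2 a (K : Set V) x t' hx ht'K hxa' ht'a
  have key : ∃ x ∈ K, ∃ y ∈ K, ∃ a, a ∉ K ∧ ∃ b, b ∉ K ∧ a ≠ b ∧ G.Adj x a ∧ G.Adj y b ∧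
      (x ≠ y ∨ ∀ z ∈ K, z = x) := by
    by_cases hxx : x = x'
    · subst hxx
      by_cases hs : ∀ z ∈ K, z = x
      · exact ⟨x, hx, x, hx, a, ha, b, hb, hba.symm, hxa, hxb, Or.inr hs⟩
      · push Not at hs
        obtain ⟨s, hs, hsx⟩ := hs
        obtain ⟨y, hy, c, hc, hyx, -, hyc⟩ := cut_edge h2 x (K : Set V) s a hs ha hsx hxa'.symm
        by_cases hca : c = a
        · subst hca
          exact ⟨x, hx, y, hy, b, hb, c, hc, hba, hxb, hyc, Or.inl hyx.symm⟩
        · exact ⟨x, hx, y, hy, a, ha, c, hc, Ne.symm hca, hxa, hyc, Or.inl hyx.symm⟩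
    · exact ⟨x, hx, x', hx', a, ha, b, hb, hba.symm, hxa, hxb, Or.inl hxx⟩
  clear hxa hxb hx hx' ha hb hba ht'a hxa' ht' ht'x
  clear a b x x'
  obtain ⟨x, hx, y, hy, a, ha, b, hb, hab, hxa, hyb, hor⟩ := key
  obtain ⟨P, hP1, hP2, hP3, hP4⟩ := order_list K x y hx hy hor
  have hHa := hout x hx a ha hxa
  have hHb := hout y hy b hb hyb
  refine ⟨a :: (P ++ [b]), ?_, ?_, ?_, ?_, ?_, ?_, ?_⟩
  · rw [List.nodup_cons, List.nodup_append]
    refine ⟨?_, hP1, by simp, ?_⟩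
    · simp [hP2, ha, hab]
    · intro c hc d hd
      simp only [List.mem_singleton] at hd
      subst hd
      rintro rfl
      exact hb ((hP2 _).1 hc)
  · rw [List.isChain_cons, List.isChain_append]
    refine ⟨?_, ?_, by simp, ?_⟩
    · intro c hc
      rw [List.head?_append, hP3] at hc
      simp at hc
      subst hc
      exact Or.inl hxa.symm
    · apply List.Pairwise.isChain
      apply List.Nodup.pairwise_of_forall_ne hP1
      intro c hc d hd hcd
      exact Or.inl (hcl c ((hP2 c).1 hc) d ((hP2 d).1 hd) hcd)
    · intro c hc d hd
      rw [hP4] at hc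
      simp at hc hd
      subst hc hd
      exact Or.inl hyb
  · intro c hc
    simp at hc
    subst hc
    exact hHa
  · intro c hc
    rw [← List.cons_append, List.getLast?_append] at hc
    simp at hc
    subst hc
    exact hHb
  · intro c hc hcH
    simp only [List.mem_cons, List.mem_append, List.not_mem_nil, or_false] at hc
    rcases hc with rfl | hc | rfl
    · exact absurd hHa hcH
    · exact ((hK c).1 ((hP2 c).1 hc)).2
    · exact absurd hHb hcH
  · intro c hc hcv
    have := (hP2 c).2 ((hK c).2 ⟨hc, hcv⟩)
    simp [this]
  · intro c hc hcH
    simp only [List.mem_cons, List.mem_append, List.not_mem_nil, or_false] at hc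
    rcases hc with rfl | hc | rfl
    · exact ⟨x, ((hK x).1 hx).1, ((hK x).1 hx).2, hxa⟩
    · exact absurd hcH ((hK c).1 ((hP2 c).1 hc)).1
    · exact ⟨y, ((hK y).1 hy).1, ((hK y).1 hy).2, hyb⟩

end light

section ham
variable {V : Type} [Fintype V] {G : SimpleGraph V} [DecidableRel G.Adj] {H : V → Prop}

lemma light_list (h2 : TwoConnected G)
    (hH : ∀ v, H v ↔ Fintype.card V + 1 ≤ 2 * G.degree v)
    (hl : ∀ u w v : V, G.Adj u w → G.Adj w v → u ≠ v → ¬ H u → ¬ H v → G.Adj u v) (m : ℕ) :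
    ∃ L : List V, L.Nodup ∧ L.IsChain (fun x y => G.Adj x y ∨ (H x ∧ H y)) ∧
      (∀ x ∈ L.head?, H x) ∧ (∀ x ∈ L.getLast?, H x) ∧
      (∀ x ∈ L, ¬ H x → ∀ y, ¬ H y → G.Adj x y → y ∈ L) ∧
      (∀ x ∈ L, H x → ∃ y ∈ L, ¬ H y ∧ G.Adj y x) ∧
      (m ≤ L.length ∨ ∀ x, ¬ H x → x ∈ L) := by
  classical
  induction m with
  | zero => exact ⟨[], by simp⟩
  | succ m ih =>
    obtain ⟨L, h1, h2', h3, h4, h5, h6, h7⟩ := ih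
    by_cases hall : ∀ x, ¬ H x → x ∈ L
    · exact ⟨L, h1, h2', h3, h4, h5, h6, Or.inr hall⟩
    have h7 : m ≤ L.length := by
      rcases h7 with h | h
      · exact h
      · exact absurd h hall
    push Not at hall
    obtain ⟨v, hv, hvL⟩ := hall
    obtain ⟨B, b1, b2, b3, b4, b5, b6, b7⟩ := block h2 hH hl v hv
    have hvB : v ∈ B := b6 v hv (Or.inl rfl)
    have hno : ∀ y ∈ L, ¬ H y → ¬ (y = v ∨ G.Adj v y) := by
      rintro y hy hyH (rfl | h)
      · exact hvL hy
      · exact hvL (h5 y hy hyH v hv h.symm)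
    refine ⟨L ++ B, ?_, ?_, ?_, ?_, ?_, ?_, ?_⟩
    · rw [List.nodup_append]
      refine ⟨h1, b1, ?_⟩
      rintro x hx y hy rfl
      by_cases hxH : H x
      · obtain ⟨y, hyL, hyH, hyx⟩ := h6 x hx hxH
        obtain ⟨y', hyH', hy', hyx'⟩ := b7 x hy hxH
        by_cases hyy : y = y'
        · subst hyy
          exact hno y hyL hyH hy'
        · exact hno y' (h5 y hyL hyH y' hyH' (hl y x y' hyx hyx'.symm hyy hyH hyH')) hyH' hy'
      · exact hno x hx hxH (b5 x hy hxH)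
    · rw [List.isChain_append]
      exact ⟨h2', b2, fun x hx y hy => Or.inr ⟨h4 x hx, b3 y hy⟩⟩
    · intro x hx
      cases L with
      | nil => exact b3 x (by simpa using hx)
      | cons c L => exact h3 x (by simpa using hx)
    · intro x hx
      rw [List.getLast?_append] at hx
      rcases hB : B.getLast? with _ | c
      · rw [hB] at hx; exact h4 x (by simpa using hx)
      · rw [hB] at hx; exact b4 x (by rw [hB]; simpa using hx)
    · intro x hx hxH y hyH hxy
      rw [List.mem_append] at hx ⊢
      rcases hx with hx | hx
      · exact Or.inl (h5 x hx hxH y hyH hxy)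
      · right
        apply b6 y hyH
        rcases b5 x hx hxH with rfl | hvx
        · exact Or.inr hxy
        · by_cases hyv : y = v
          · exact Or.inl hyv
          · exact Or.inr (hl v x y hvx hxy (Ne.symm hyv) hv hyH)
    · intro x hx hxH
      rw [List.mem_append] at hx
      rcases hx with hx | hx
      · obtain ⟨y, hy, hy'⟩ := h6 x hx hxH
        exact ⟨y, List.mem_append_left _ hy, hy'⟩
      · obtain ⟨y, hyH, hy, hyx⟩ := b7 x hx hxH
        exact ⟨y, List.mem_append_right _ (b6 y hyH hy), hyH, hyx⟩
    · left
      have := List.length_pos_of_mem hvB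
      rw [List.length_append]
      omega

lemma ham_clo (h2 : TwoConnected G)
    (hH : ∀ v, H v ↔ Fintype.card V + 1 ≤ 2 * G.degree v)
    (hl : ∀ u w v : V, G.Adj u w → G.Adj w v → u ≠ v → ¬ H u → ¬ H v → G.Adj u v)
    (G' : SimpleGraph V) (hG : G ≤ G') (hG' : ∀ x y, x ≠ y → H x → H y → G'.Adj x y) :
    ∃ p, IdxCycle G' (Fintype.card V) p := by
  classical
  have hn := h2.1
  obtain ⟨L, h1, h2', h3, h4, h5, h6, h7⟩ := light_list h2 hH hl (Fintype.card V + 1)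
  have h7 : ∀ x, ¬ H x → x ∈ L := by
    rcases h7 with h | h
    · have := h1.length_le_card
      omega
    · exact h
  set M := (Finset.univ.filter (fun x => x ∉ L)).toList with hM
  have hMm : ∀ x, x ∈ M ↔ x ∉ L := by intro x; simp [hM]
  have hMH : ∀ x ∈ M, H x := fun x hx => by
    by_contra hc
    exact (hMm x).1 hx (h7 x hc)
  have hMn : M.Nodup := Finset.nodup_toList _
  have f1 : (L ++ M).Nodup := by
    rw [List.nodup_append]
    refine ⟨h1, hMn, ?_⟩
    rintro x hx y hy rfl
    exact (hMm x).1 hy hx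
  have f2 : (L ++ M).IsChain (fun x y => G.Adj x y ∨ (H x ∧ H y)) := by
    rw [List.isChain_append]
    refine ⟨h2', ?_, fun x hx y hy => Or.inr ⟨h4 x hx, hMH y (List.mem_of_mem_head? hy)⟩⟩
    apply List.Pairwise.isChain
    apply List.Nodup.pairwise_of_forall_ne hMn
    exact fun c hc d hd _ => Or.inr ⟨hMH c hc, hMH d hd⟩
  have f3 : ∀ x ∈ (L ++ M).head?, H x := by
    intro x hx
    cases L with
    | nil => exact hMH x (List.mem_of_mem_head? (by simpa using hx))
    | cons c L => exact h3 x (by simpa using hx)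
  have f4 : ∀ x ∈ (L ++ M).getLast?, H x := by
    intro x hx
    rw [List.getLast?_append] at hx
    rcases hB : M.getLast? with _ | c
    · rw [hB] at hx; exact h4 x (by simpa using hx)
    · rw [hB] at hx
      apply hMH x
      apply List.mem_of_getLast? 
      rw [hB]; simpa using hx
  have f5 : ∀ x, x ∈ L ++ M := by
    intro x
    rw [List.mem_append, hMm]
    exact em _
  generalize L ++ M = F at f1 f2 f3 f4 f5
  have hlen : F.length = Fintype.card V := by
    rw [← List.toFinset_card_of_nodup f1, ← Finset.card_univ]
    congr 1
    ext x
    simp [f5]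
  rw [← hlen] at hn ⊢
  have hR : ∀ x y, x ≠ y → (G.Adj x y ∨ (H x ∧ H y)) → G'.Adj x y := by
    rintro x y hxy (h | ⟨ha, hb⟩)
    · exact hG h
    · exact hG' x y hxy ha hb
  have hg : ∀ i (hi : i < F.length), F.getD i (F[0]'(by omega)) = F[i] := by
    intro i hi
    exact List.getD_eq_getElem F _ hi
  refine ⟨fun i => F.getD i (F[0]'(by omega)), ⟨?_, ?_⟩, ?_⟩
  · intro i j hi hj hij
    dsimp only at hij
    rw [hg i hi, hg j hj] at hij
    exact (f1.getElem_inj_iff).1 hij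
  · intro i hi
    dsimp only
    rw [hg i (by omega), hg (i + 1) hi]
    apply hR
    · intro h
      have := (f1.getElem_inj_iff).1 h
      omega
    · exact List.isChain_iff_getElem.1 f2 i hi
  · dsimp only
    rw [hg _ (by omega), hg _ (by omega)]
    apply hG'
    · intro h
      have := (f1.getElem_inj_iff).1 h
      omega
    · apply f4
      rw [List.getLast?_eq_getElem?]
      simp
    · apply f3
      rw [List.head?_eq_getElem?]
      simp

lemma ham (h2 : TwoConnected G)
    (hH : ∀ v, H v ↔ Fintype.card V + 1 ≤ 2 * G.degree v)
    (hl : ∀ u w v : V, G.Adj u w → G.Adj w v → u ≠ v → ¬ H u → ¬ H v → G.Adj u v) :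
    ∃ p, IdxCycle G (Fintype.card V) p := by
  classical
  have hn := h2.1
  by_contra hcon
  obtain ⟨G₁, -, hmax⟩ := (Set.toFinite {G₁ : SimpleGraph V | G ≤ G₁ ∧
    ¬ ∃ p, IdxCycle G₁ (Fintype.card V) p}).exists_le_maximal (a := G) ⟨le_refl _, hcon⟩
  obtain ⟨hGG, hnh⟩ := hmax.prop
  have : ∃ u v, u ≠ v ∧ H u ∧ H v ∧ ¬ G₁.Adj u v := by
    by_contra! hc
    exact hnh (ham_clo h2 hH hl G₁ hGG hc)
  obtain ⟨u, v, huv, hu, hv, hadj⟩ := this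
  have hham : ∃ p, IdxCycle (G₁ ⊔ edge u v) (Fintype.card V) p := by
    by_contra hc
    have h4 := hmax.le_of_ge (y := G₁ ⊔ edge u v) ⟨hGG.trans le_sup_left, hc⟩ le_sup_left
    apply hadj
    apply h4
    right
    rw [edge_adj]
    exact ⟨Or.inl ⟨rfl, rfl⟩, huv⟩
  obtain ⟨p, hp⟩ := hham
  have hsup : ∀ x y, (G₁ ⊔ edge u v).Adj x y → G₁.Adj x y ∨ (x = u ∧ y = v) ∨ (x = v ∧ y = u) := by
    intro x y h
    rw [sup_adj, edge_adj] at h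
    rcases h with h | ⟨h, -⟩
    · exact Or.inl h
    · right
      tauto
  -- rotate so that the closing edge is the only possibly bad one
  have hrot : ∃ q, IdxCycle (G₁ ⊔ edge u v) (Fintype.card V) q ∧
      ((q (Fintype.card V - 1) = u ∧ q 0 = v) ∨ (q (Fintype.card V - 1) = v ∧ q 0 = u)) := by
    by_cases hb : (p (Fintype.card V - 1) = u ∧ p 0 = v) ∨ (p (Fintype.card V - 1) = v ∧ p 0 = u)
    · exact ⟨p, hp, hb⟩
    by_cases hi : ∃ i, i + 1 < Fintype.card V ∧ ¬ G₁.Adj (p i) (p (i + 1))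
    · obtain ⟨i, hi, hia⟩ := hi
      obtain ⟨q, hq, hq1, hq2⟩ := hp.rotate i hi
      refine ⟨q, hq, ?_⟩
      rw [hq1, hq2]
      exact (hsup _ _ (hp.1.2 i hi)).resolve_left hia
    · push Not at hi
      exact absurd ⟨p, ⟨hp.1.1, hi⟩, (hsup _ _ hp.2).resolve_right hb⟩ hnh
  obtain ⟨q, hq, hqe⟩ := hrot
  have hqp : IdxPath G₁ (Fintype.card V) q := by
    refine ⟨hq.1.1, fun i hi => ?_⟩
    rcases hsup _ _ (hq.1.2 i hi) with h | h
    · exact h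
    · exfalso
      have key : (q i = q (Fintype.card V - 1)) ∨
          (q i = q 0 ∧ q (i + 1) = q (Fintype.card V - 1)) := by
        rcases h with ⟨h, h'⟩ | ⟨h, h'⟩ <;> rcases hqe with ⟨e, e'⟩ | ⟨e, e'⟩ <;>
          simp [h, h', e, e']
      rcases key with h | ⟨h, h'⟩
      · have := hq.1.1 _ _ (by omega) (by omega) h
        omega
      · have := hq.1.1 _ _ (by omega) (by omega) h
        have := hq.1.1 _ _ (by omega) (by omega) h'
        omega
  apply hnh
  apply crossing G₁ hqp hn
  have hmono : ∀ x, H x → Fintype.card V + 1 ≤ 2 * G₁.degree x := by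
    intro x hx
    have := degree_le_of_le hGG (v := x)
    have := (hH x).1 hx
    omega
  have hu' := hmono u hu
  have hv' := hmono v hv
  rcases hqe with ⟨e, e'⟩ | ⟨e, e'⟩ <;> rw [e, e'] <;> omega

lemma consecutive (h2 : TwoConnected G)
    (hH : ∀ v, H v ↔ Fintype.card V + 1 ≤ 2 * G.degree v)
    (hl : ∀ u w v : V, G.Adj u w → G.Adj w v → u ≠ v → ¬ H u → ¬ H v → G.Adj u v)
    (p : ℕ → V) (hp : IdxCycle G (Fintype.card V) p) (h0 : H (p 0)) :
    ∃ q, IdxCycle G (Fintype.card V) q ∧ H (q 0) ∧ H (q (Fintype.card V - 1)) := by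
  classical
  have hn := h2.1
  by_contra! hcon
  have hlast : ¬ H (p (Fintype.card V - 1)) := hcon p hp h0
  have hsucc : ∀ i, i + 1 < Fintype.card V → H (p i) → ¬ H (p (i + 1)) := by
    intro i hi hi1 hi2
    obtain ⟨q, hq, hq1, hq2⟩ := hp.rotate i hi
    exact hcon q hq (hq2 ▸ hi2) (hq1 ▸ hi1)
  have h1 : ¬ H (p 1) := hsucc 0 (by omega) h0
  -- all light vertices are equivalent to `p 1`
  have hall : ∀ i, i < Fintype.card V → ¬ H (p i) → p i = p 1 ∨ G.Adj (p 1) (p i) := by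
    intro i
    induction i using Nat.strong_induction_on with
    | _ i ih =>
      intro hi hiH
      have step : ∀ x y, ¬ H x → ¬ H y → (x = p 1 ∨ G.Adj (p 1) x) → (y = x ∨ G.Adj x y) →
          (y = p 1 ∨ G.Adj (p 1) y) := by
        rintro x y hx hy (rfl | hx1) (rfl | hy1)
        · exact Or.inl rfl
        · exact Or.inr hy1
        · exact Or.inr hx1
        · by_cases hy1' : y = p 1
          · exact Or.inl hy1'
          · exact Or.inr (hl _ _ _ hx1 hy1 (Ne.symm hy1') h1 hy)
      match i, ih, hi, hiH with
      | 0, _, _, hiH => exact absurd h0 hiH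
      | 1, _, _, _ => exact Or.inl rfl
      | (j + 2), ih, hi, hiH =>
        by_cases hj : H (p (j + 1))
        · have hj0 : ¬ H (p j) := fun h => hsucc j (by omega) h hj
          refine step (p j) _ hj0 hiH (ih j (by omega) (by omega) hj0) (Or.inr ?_)
          refine hl _ (p (j + 1)) _ (hp.1.2 j (by omega)) (hp.1.2 (j + 1) hi) ?_ hj0 hiH
          intro h
          have := hp.1.1 _ _ (by omega) (by omega) h
          omega
        · exact step (p (j + 1)) _ hj hiH (ih (j + 1) (by omega) (by omega) hj)
            (Or.inr (hp.1.2 (j + 1) hi))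
  set n := Fintype.card V with hndef
  set A := (Finset.range n).filter (fun i => H (p i)) with hA
  set B := (Finset.range n).filter (fun i => ¬ H (p i)) with hB
  have hAB : A.card + B.card = n := by
    have := Finset.card_filter_add_card_filter_not (s := Finset.range n) (fun i => H (p i))
    rwa [Finset.card_range] at this
  have hAn : ∀ i ∈ A, i + 1 < n ∧ H (p i) := by
    intro i hi
    simp only [hA, Finset.mem_filter, Finset.mem_range] at hi
    refine ⟨?_, hi.2⟩
    by_contra hc
    apply hlast
    rw [show n - 1 = i by omega]
    exact hi.2
  have himg : A.image (· + 1) ⊆ B := by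
    intro x hx
    obtain ⟨i, hi, rfl⟩ := Finset.mem_image.1 hx
    have := hAn i hi
    simp only [hB, Finset.mem_filter, Finset.mem_range]
    exact ⟨this.1, hsucc i this.1 this.2⟩
  have hic : (A.image (· + 1)).card = A.card :=
    Finset.card_image_of_injective _ (add_left_injective 1)
  have hdeg := idx_degree G hp.1.1 (p 1)
  have hlt : ¬ (n + 1 ≤ 2 * G.degree (p 1)) := fun h => h1 ((hH _).2 h)
  have h1B : 1 ∈ B := by
    simp only [hB, Finset.mem_filter, Finset.mem_range]
    exact ⟨by omega, h1⟩
  have hBsub : ∀ i ∈ B.erase 1, i < n ∧ G.Adj (p 1) (p i) := by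
    intro i hi
    simp only [hB, Finset.mem_erase, Finset.mem_filter, Finset.mem_range] at hi
    refine ⟨hi.2.1, (hall i hi.2.1 hi.2.2).resolve_left ?_⟩
    intro h
    exact hi.1 (hp.1.1 _ _ hi.2.1 (by omega) h)
  have h01 : G.Adj (p 1) (p 0) := (hp.1.2 0 (by omega)).symm
  have h12 : G.Adj (p 1) (p 2) := hp.1.2 1 (by omega)
  have hBe : (B.erase 1).card + 1 = B.card := Finset.card_erase_add_one h1B
  by_cases h2H : H (p 2)
  · have hsub : insert 0 (insert 2 (B.erase 1)) ⊆
        (Finset.range n).filter (fun i => G.Adj (p 1) (p i)) := by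
      intro x hx
      simp only [Finset.mem_insert] at hx
      rw [Finset.mem_filter, Finset.mem_range]
      rcases hx with rfl | rfl | hx
      · exact ⟨by omega, h01⟩
      · exact ⟨by omega, h12⟩
      · exact hBsub x hx
    have hc := Finset.card_le_card hsub
    rw [hdeg, Finset.card_insert_of_notMem (by simp [hB, h0]),
      Finset.card_insert_of_notMem (by simp [hB, h2H])] at hc
    have := Finset.card_le_card himg
    omega
  · have hsub : insert 0 (B.erase 1) ⊆
        (Finset.range n).filter (fun i => G.Adj (p 1) (p i)) := by
      intro x hx
      simp only [Finset.mem_insert] at hx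
      rw [Finset.mem_filter, Finset.mem_range]
      rcases hx with rfl | hx
      · exact ⟨by omega, h01⟩
      · exact hBsub x hx
    have hc := Finset.card_le_card hsub
    rw [hdeg, Finset.card_insert_of_notMem (by simp [hB, h0])] at hc
    have h2B : 2 ∈ B := by
      simp only [hB, Finset.mem_filter, Finset.mem_range]
      exact ⟨by omega, h2H⟩
    have himg2 : A.image (· + 1) ⊆ B.erase 2 := by
      intro x hx
      rw [Finset.mem_erase]
      refine ⟨?_, himg hx⟩
      rintro rfl
      obtain ⟨i, hi, hi2⟩ := Finset.mem_image.1 hx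
      have : i = 1 := by omega
      subst this
      exact h1 (hAn 1 hi).2
    have := Finset.card_le_card himg2
    have := Finset.card_erase_add_one h2B
    omega

end ham

theorem pancyclic_of_P3_f1_heavy {V : Type} [Fintype V] (G : SimpleGraph V)
    [DecidableRel G.Adj] (hn : 3 ≤ Fintype.card V) (h2 : TwoConnected G)
    (h : ∀ u w v : V, G.Adj u w → G.Adj w v → u ≠ v → ¬ G.Adj u v →
      Fintype.card V + 1 ≤ 2 * max (G.degree u) (G.degree v)) :
    IsPancyclic G := by 
  classical
  let H : V → Prop := fun v => Fintype.card V + 1 ≤ 2 * G.degree v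
  have hH : ∀ v, H v ↔ Fintype.card V + 1 ≤ 2 * G.degree v := fun v => Iff.rfl
  have hl : ∀ u w v : V, G.Adj u w → G.Adj w v → u ≠ v → ¬ H u → ¬ H v → G.Adj u v := by
    intro u w v huw hwv huv hu hv
    by_contra hc
    have h5 := h u w v huw hwv huv hc
    rw [hH] at hu hv
    rcases max_choice (G.degree u) (G.degree v) with h6 | h6 <;> rw [h6] at h5 <;> omega
  obtain ⟨p, hp⟩ := ham h2 hH hl
  have hex : ∃ q, IdxCycle G (Fintype.card V) q ∧ H (q 0) := by
    have hheavy : ∃ a, H a := by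
      by_contra! hc
      obtain ⟨B, -, -, hB, -, -, hB', -⟩ := block h2 hH hl (p 0) (hc _)
      have hmem := hB' (p 0) (hc _) (Or.inl rfl)
      cases B with
      | nil => simp at hmem
      | cons c B => exact hc c (hB c (by simp))
    obtain ⟨a, ha⟩ := hheavy
    obtain ⟨i, hi, rfl⟩ := idx_surj hp.1.1 a
    cases i with
    | zero => exact ⟨p, hp, ha⟩
    | succ i =>
      obtain ⟨q, hq, -, hq2⟩ := hp.rotate i hi
      exact ⟨q, hq, hq2 ▸ ha⟩
  obtain ⟨q, hq, hq0⟩ := hex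
  obtain ⟨r, hr, hr0, hr1⟩ := consecutive h2 hH hl q hq hq0
  apply bondy G hr
  rw [hH] at hr0 hr1
  omega
end

section
/- Let G be a graph on n vertices with a Hamilton cycle C. If there exist two vertices x, y of G that are consecutive on C (i.e., d_C(x,y) = 1) and satisfy d(x) + d(y) ≥ n, then G is pancyclic, unless G is bipartite, or G contains cycles of every length from 3 to n except length n − 1. -/
open SimpleGraph

/-- Abstract constraints coming from the absence of a cycle of length `s + 3`. -/
structure Sys (N s : ℕ) (A B : ℕ → Prop) : Prop where
  hs : s + 3 ≤ N
  a0 : A 0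
  bN : B (N - 1)
  c1 : ∀ i, i + s < N → A i → ¬ B (i + s)
  c1' : ∀ i, i + s < N → B i → ¬ A (i + s)
  c2a : ∀ i, i + s + 1 < N → A i → ¬ A (i + s + 1)
  c2b : ∀ i, i + s + 1 < N → B i → ¬ B (i + s + 1)
  c3 : ∀ c k l, B c → c < k → k ≤ l → l < N → c + l + 1 = s + k →
    ¬ (A k ∧ B l) ∧ ¬ (B k ∧ A l)
  c3' : ∀ d k l, A d → k ≤ l → l < d → d < N → l + N = s + d + k →
    ¬ (A k ∧ B l) ∧ ¬ (B k ∧ A l)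
  cnt1 : ∀ i, i + s < N → ¬ B (i + s) → A i
  cnt2 : ∀ e, e < s → ¬ B e → A (e + N - s)
  cover : (∀ i, i < N → ¬ (A i ∧ B i)) → ∀ i, i < N → A i ∨ B i

namespace Sys

variable {N s : ℕ} {A B : ℕ → Prop}

theorem upB (S : Sys N s A B) {e r : ℕ} (he : e < s) (hB : ¬ B e) (hA : A r)
    (hr : r + s < N) : ¬ B (e + r) := by
  have hs := S.hs
  intro h
  have h1 := S.cnt2 e he hB
  exact (S.c3' (e + N - s) r (e + r) h1 (by omega) (by omega) (by omega) (by omega)).1 ⟨hA, h⟩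

theorem upA (S : Sys N s A B) {e i : ℕ} (he : e < s) (hB : B e) (hA : ¬ A i)
    (hr : i + s < N) : ¬ A (e + i + 1) := by
  have hs := S.hs
  intro h
  have h1 : B (i + s) := by
    by_contra h2
    exact hA (S.cnt1 i hr h2)
  exact (S.c3 e (e + i + 1) (i + s) hB (by omega) (by omega) (by omega) (by omega)).1 ⟨h, h1⟩

theorem dn (S : Sys N s A B) {c a : ℕ} (hc : c < s) (hB : B c) (ha : s ≤ a) (haN : a < N)
    (hA : A a) : ¬ B (a + c + 1 - s) := by
  have hs := S.hs
  intro h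
  exact (S.c3 c (a + c + 1 - s) a hB (by omega) (by omega) (by omega) (by omega)).2 ⟨h, hA⟩

theorem dn' (S : Sys N s A B) {b e : ℕ} (hb : b + s < N) (hB : B b) (he : e < s)
    (hE : ¬ B e) : ¬ A (b + e) := by
  have hs := S.hs
  intro h
  have h1 := S.cnt2 e he hE
  exact (S.c3' (e + N - s) b (b + e) h1 (by omega) (by omega) (by omega) (by omega)).2 ⟨hB, h⟩

theorem cnt2' (S : Sys N s A B) {e f : ℕ} (he : e < s) (hf : f + s = e + N) (h : ¬ A f) :
    B e := by
  by_contra h1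
  have h2 := S.cnt2 e he h1
  rw [show e + N - s = f by omega] at h2
  exact h h2

/-- The case of an initial segment is impossible. -/
theorem caseI (S : Sys N s A B) (hs1 : 1 ≤ s) (h : A 1 ∨ ¬ A (N - s - 2)) : False := by
  have hs := S.hs
  have down : ∀ e, e + 1 < s → B (e + 1) → B e := by
    intro e he hB
    rcases h with h | h
    · by_contra h1
      exact S.upB (by omega) h1 h (by omega) hB
    · have := S.upA (e := e + 1) (i := N - s - 2) he hB h (by omega)
      exact S.cnt2' (by omega) (by omega) this
  have down' : ∀ d e, e + d < s → B (e + d) → B e := by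
    intro d
    induction d with
    | zero => intro e _ h; exact h
    | succ d ih => intro e h1 h2; exact ih e (by omega) (down _ (by omega) h2)
  have hg2 : ¬ B (N - s - 2) := by
    intro h1
    have := S.c2b _ (by omega) h1
    rw [show N - s - 2 + s + 1 = N - 1 by omega] at this
    exact this S.bN
  -- `B (s-1)` impossible
  have hBs : ¬ B (s - 1) := by
    intro h1
    have h0 : B 0 := down' (s - 1) 0 (by omega) (by simpa using h1)
    have hlt : s - 1 < N - s - 2 := by
      by_contra h2
      apply hg2
      apply down' (s - 1 - (N - s - 2)) (N - s - 2) (by omega)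
      rw [show N - s - 2 + (s - 1 - (N - s - 2)) = s - 1 by omega]; exact h1
    have h3 := S.c2b _ (by omega) h1
    rw [show s - 1 + s + 1 = s + s by omega] at h3
    have h4 := S.cnt1 s (by omega) h3
    have := S.c1' 0 (by omega) h0
    rw [Nat.zero_add] at this
    exact this h4
  classical
  have hex : ∃ m, ¬ B m := ⟨_, hBs⟩
  obtain ⟨m, hm, hmin⟩ : ∃ m, ¬ B m ∧ ∀ j < m, B j :=
    ⟨Nat.find hex, Nat.find_spec hex, fun j hj => by
      have := Nat.find_min hex hj
      simpa using this⟩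
  have hms : m < s := by
    by_contra h1
    exact hBs (hmin _ (by omega))
  have hup : ∀ e, m ≤ e → e < s → ¬ B e := by
    intro e h1 h2 h3
    apply hm
    apply down' (e - m) m (by omega)
    rw [show m + (e - m) = e by omega]; exact h3
  have hAN : A (N - 1) := by
    have := S.cnt2 (s - 1) (by omega) hBs
    rwa [show s - 1 + N - s = N - 1 by omega] at this
  have hgm : A (m + N - s) := S.cnt2 m hms hm
  have hnB : ¬ B (N - s + m - 1) := by
    rcases Nat.eq_zero_or_pos m with h0 | h0
    · intro h1
      have := S.c1' _ (by omega) h1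
      rw [show N - s + m - 1 + s = N - 1 by omega] at this
      exact this hAN
    · have := S.dn (c := m - 1) (a := N - 1) (by omega) (hmin _ (by omega)) (by omega) (by omega) hAN
      rwa [show N - 1 + (m - 1) + 1 - s = N - s + m - 1 by omega] at this
  by_cases hc : s ≤ N - s + m - 1
  · have h1 : A (N - s + m - 1 - s) := by
      apply S.cnt1 _ (by omega)
      rwa [show N - s + m - 1 - s + s = N - s + m - 1 by omega]
    have h2 := S.c2a _ (by omega) h1
    rw [show N - s + m - 1 - s + s + 1 = m + N - s by omega] at h2
    exact h2 hgm
  · have h1 : A (s + 1) := by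
      have := S.cnt2 (s + 1 + s - N) (by omega) (hup _ (by omega) (by omega))
      rwa [show s + 1 + s - N + N - s = s + 1 by omega] at this
    have := S.c2a 0 (by omega) S.a0
    rw [Nat.zero_add] at this
    exact this h1

theorem g1 (S : Sys N s A B) : ¬ A (N - s - 1) := by
  have hs := S.hs
  intro h
  have := S.c1 _ (by omega) h
  rw [show N - s - 1 + s = N - 1 by omega] at this
  exact this S.bN

theorem ofDisjoint (S : Sys N s A B) (hg : 2 * s ≤ N)
    (hd : ∀ i, i < N → ¬ (A i ∧ B i)) :
    Even N ∧ ∀ i, i < N → (A i ↔ Even i) ∧ (B i ↔ ¬ Even i) := by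
  have hs := S.hs
  have hcov := S.cover hd
  have hBA : ∀ i, i < N → (B i ↔ ¬ A i) := by
    intro i hi
    have h1 := hd i hi
    have h2 := hcov i hi
    tauto
  have hper : ∀ i, i + s < N → (A (i + s) ↔ A i) := by
    intro i hi
    have h1 := S.c1 i hi
    have h2 := S.cnt1 i hi
    have h3 := hBA (i + s) hi
    tauto
  have halt : ∀ i, i + s + 1 < N → (A (i + 1) ↔ ¬ A i) := by
    intro i hi
    have h1 := S.c2a i hi
    have h2 := S.c2b i hi
    have h3 := hBA (i + s + 1) hi
    have h4 := hBA i (by omega)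
    have h5 := hper (i + 1) (by omega)
    rw [show i + 1 + s = i + s + 1 by omega] at h5
    tauto
  have hev : ∀ i, i + s < N → (A i ↔ Even i) := by
    intro i
    induction i with
    | zero => intro _; simp [S.a0]
    | succ i ih =>
      intro h
      rw [halt i (by omega), ih (by omega), Nat.even_add_one]
  have hgE : ¬ Even (N - s - 1) := by
    rw [← hev _ (by omega)]; exact S.g1
  have hsE : Even s := by
    by_cases h : s + s < N
    · rw [← hev s h]
      have := hper 0 (by omega)
      rw [Nat.zero_add] at this
      exact this.2 S.a0
    · rw [show N - s - 1 = s - 1 by omega] at hgE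
      rw [Nat.even_iff] at *
      omega
  have hNE : Even N := by
    rw [Nat.even_iff] at *
    omega
  have hAE : ∀ i, i < N → (A i ↔ Even i) := by
    intro i hi
    by_cases h : i + s < N
    · exact hev i h
    · have h1 := hper (i - s) (by omega)
      rw [show i - s + s = i by omega, hev (i - s) (by omega)] at h1
      rw [h1, Nat.even_iff, Nat.even_iff]
      rw [Nat.even_iff] at hsE
      omega
  exact ⟨hNE, fun i hi => ⟨hAE i hi, by rw [hBA i hi, hAE i hi]⟩⟩

theorem large (S : Sys N s A B) (hg : N < 2 * s) (hA1 : ¬ A 1) (hA2 : A (N - s - 2))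
    (hB0 : ¬ B 0) (hBs : B (s - 1)) :
    Even N ∧ ∀ i, i < N → (A i ↔ Even i) ∧ (B i ↔ ¬ Even i) := by
  have hs := S.hs
  obtain ⟨h, rfl⟩ : ∃ h, N = s + h + 2 := ⟨N - s - 2, by omega⟩
  rw [show s + h + 2 - s - 2 = h by omega] at hA2
  have hg1 := S.g1
  rw [show s + h + 2 - s - 1 = h + 1 by omega] at hg1
  have hh : 1 < h := by
    rcases Nat.lt_trichotomy h 1 with h1 | h1 | h1
    · omega
    · subst h1; exact absurd hA2 hA1
    · exact h1
  have hU : ∀ i, i < h → (A i ∨ ¬ A (i + 1)) → ¬ B i := by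
    intro i hi hX hB
    rcases hX with hX | hX
    · have := S.upB (e := 0) (by omega) hB0 hX (by omega)
      rw [Nat.zero_add] at this
      exact this hB
    · have h1 := S.c2b i (by omega) hB
      rw [show i + s + 1 = i + 1 + s by omega] at h1
      exact hX (S.cnt1 _ (by omega) h1)
  have hclass : ∀ m e, e + h * m < s → ¬ B e → ¬ B (e + h * m) := by
    intro m
    induction m with
    | zero => intro e _ h1; simpa using h1
    | succ m ih =>
      intro e h1 h2
      rw [Nat.mul_succ] at h1 ⊢
      have := S.upB (by omega) (ih e (by omega) h2) hA2 (by omega)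
      rwa [Nat.add_assoc] at this
  have htop : ∀ j, j < h → ¬ B (s + j - h) → ¬ A (j + 1) ∧ A (j + 2) := by
    intro j hj hB
    constructor
    · intro h1
      have h2 := S.c2a _ (by omega) h1
      exact hB (S.cnt2' (by omega) (by omega) h2)
    · by_contra h1
      have h2 := S.upA (by omega) hBs h1 (by omega)
      exact hB (S.cnt2' (by omega) (by omega) h2)
  have hstep : ∀ j, j < h → (A ((j + s) % h) ∨ ¬ A ((j + s) % h + 1)) →
      ¬ A (j + 1) ∧ A (j + 2) := by
    intro j hj hX
    apply htop j hj
    have hmod : (j + s) % h < h := Nat.mod_lt _ (by omega)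
    have h1 := hU _ hmod hX
    have h2 := Nat.mod_add_div (j + s) h
    have h3 : 1 ≤ (j + s) / h := by
      rw [Nat.one_le_div_iff (by omega)]; omega
    obtain ⟨q, hq⟩ : ∃ q, (j + s) / h = q + 1 := ⟨(j + s) / h - 1, by omega⟩
    rw [hq, Nat.mul_succ] at h2
    have h4 := hclass q _ (by omega) h1
    rwa [show (j + s) % h + h * q = s + j - h by omega] at h4
  have hiter : ∀ j, j < h → (A j ∨ ¬ A (j + 1)) → ∀ m, m < h →
      (A ((j + (h - m) * s) % h) ∨ ¬ A ((j + (h - m) * s) % h + 1)) := by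
    intro j hj hX m
    induction m with
    | zero =>
      intro _
      rw [Nat.sub_zero, Nat.add_mul_mod_self_left, Nat.mod_eq_of_lt hj]
      exact hX
    | succ m ih =>
      intro hm
      have h1 := ih (by omega)
      right
      refine (hstep _ (Nat.mod_lt _ (by omega)) ?_).1
      rw [Nat.mod_add_mod]
      have : j + (h - (m + 1)) * s + s = j + (h - m) * s := by
        rw [Nat.add_assoc]
        congr 1
        rw [show h - m = (h - (m + 1)) + 1 by omega, Nat.succ_mul]
      rw [this]
      exact h1
  have hY : ∀ j, j < h → (A j ∨ ¬ A (j + 1)) → ¬ A (j + 1) ∧ A (j + 2) := by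
    intro j hj hX
    apply hstep j hj
    have := hiter j hj hX (h - 1) (by omega)
    rwa [show h - (h - 1) = 1 by omega, Nat.one_mul] at this
  have hev : ∀ m, 2 * m ≤ h → A (2 * m) := by
    intro m
    induction m with
    | zero => intro _; exact S.a0
    | succ m ih =>
      intro hm
      exact (hY (2 * m) (by omega) (Or.inl (ih (by omega)))).2
  have hod : ∀ m, 2 * m < h → ¬ A (2 * m + 1) := by
    intro m hm
    exact (hY (2 * m) hm (Or.inl (hev m (by omega)))).1
  have hhE : h % 2 = 0 := by
    by_contra h1
    have := hod (h / 2) (by omega)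
    rw [show 2 * (h / 2) + 1 = h by omega] at this
    exact this hA2
  have hA0 : ∀ i, i < h + 2 → (A i ↔ i % 2 = 0) := by
    intro i hi
    constructor
    · intro h1
      by_contra h2
      by_cases h3 : i = h + 1
      · subst h3; exact hg1 h1
      · have := hod (i / 2) (by omega)
        rw [show 2 * (i / 2) + 1 = i by omega] at this
        exact this h1
    · intro h1
      have := hev (i / 2) (by omega)
      rwa [show 2 * (i / 2) = i by omega] at this
  have hUe : ∀ m, 2 * m < s → ¬ B (2 * m) := by
    intro m
    induction m with
    | zero => intro _; exact hB0
    | succ m ih =>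
      intro hm
      exact S.upB (e := 2 * m) (r := 2) (by omega) (ih (by omega)) ((hA0 2 (by omega)).2 rfl) (by omega)
  have hsE : s % 2 = 0 := by
    by_contra h1
    have := hUe (s / 2) (by omega)
    rw [show 2 * (s / 2) = s - 1 by omega] at this
    exact this hBs
  have hBo : ∀ m, 2 * m + 1 ≤ s → B (s - (2 * m + 1)) := by
    intro m
    induction m with
    | zero => intro _; exact hBs
    | succ m ih =>
      intro hm
      have h1 : ¬ A (h - 1) := by
        rw [hA0 _ (by omega)]; omega
      have h2 := S.upA (by omega) (ih (by omega)) h1 (by omega)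
      exact S.cnt2' (by omega) (by omega) h2
  have hBB : ∀ e, e < s → (B e ↔ ¬ e % 2 = 0) := by
    intro e he
    constructor
    · intro h1 h2
      have := hUe (e / 2) (by omega)
      rw [show 2 * (e / 2) = e by omega] at this
      exact this h1
    · intro h1
      have := hBo ((s - e) / 2) (by omega)
      rwa [show s - (2 * ((s - e) / 2) + 1) = e by omega] at this
  refine ⟨by rw [Nat.even_iff]; omega, fun i hi => ?_⟩
  rw [Nat.even_iff]
  constructor
  · by_cases h1 : i < h + 2
    · exact hA0 i h1
    · have h2 : A i ↔ ¬ B (i - (h + 2)) := by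
        constructor
        · intro h3 h4
          exact (S.c3 (i - (h + 2)) i (s + h + 2 - 1) h4 (by omega) (by omega) (by omega)
            (by omega)).1 ⟨h3, S.bN⟩
        · intro h3
          have := S.cnt2 _ (by omega) h3
          rwa [show i - (h + 2) + (s + h + 2) - s = i by omega] at this
      rw [h2, hBB _ (by omega)]
      omega
  · by_cases h1 : i < s
    · exact hBB i h1
    · have h2 : B i ↔ ¬ A (i - s) := by
        have h3 := S.c1 (i - s) (by omega)
        have h4 := S.cnt1 (i - s) (by omega)
        rw [show i - s + s = i by omega] at h3 h4
        tauto
      rw [h2, hA0 _ (by omega)]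
      omega

/-- The main combinatorial fact: the neighbours alternate. -/
theorem alternate (S : Sys N s A B) :
    Even N ∧ ∀ i, i < N → (A i ↔ Even i) ∧ (B i ↔ ¬ Even i) := by
  have hs := S.hs
  rcases Nat.eq_zero_or_pos s with h0 | hpos
  · subst h0
    refine S.ofDisjoint (by omega) fun i hi h => ?_
    exact S.c1 i hi h.1 h.2
  have hA1 : ¬ A 1 := fun h => S.caseI hpos (Or.inl h)
  have hA2 : A (N - s - 2) := by
    by_contra h
    exact S.caseI hpos (Or.inr h)
  have hBs : B (s - 1) := by
    by_contra h
    have hd : ∀ d r, r + d + s < N → A (r + d) → A r := by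
      intro d
      induction d with
      | zero => intro r _ h1; exact h1
      | succ d ih =>
        intro r h1 h2
        apply ih r (by omega)
        have h3 := S.upB (e := s - 1) (by omega) h h2 (by omega)
        apply S.cnt1 _ (by omega)
        rwa [show s - 1 + (r + (d + 1)) = r + d + s by omega] at h3
    apply hA1
    apply hd (N - s - 3) 1 (by omega)
    rwa [show 1 + (N - s - 3) = N - s - 2 by omega]
  have hB0 : ¬ B 0 := by
    intro h
    have hd : ∀ d, 1 + d + s < N → ¬ A (1 + d) := by
      intro d
      induction d with
      | zero => intro _; exact hA1
      | succ d ih =>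
        intro h1
        have h3 := S.upA (e := 0) (by omega) h (ih (by omega)) (by omega)
        rwa [show 0 + (1 + d) + 1 = 1 + (d + 1) by omega] at h3
    have := hd (N - s - 3) (by omega)
    rw [show 1 + (N - s - 3) = N - s - 2 by omega] at this
    exact this hA2
  by_cases hg : 2 * s ≤ N
  · refine S.ofDisjoint hg fun i hi h => ?_
    by_cases h1 : i + s < N
    · exact S.dn' (e := 0) h1 h.2 hpos hB0 h.1
    · have := S.dn (c := s - 1) (by omega) hBs (by omega) hi h.1
      rw [show i + (s - 1) + 1 - s = i by omega] at this
      exact this h.2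
  · exact S.large (by omega) hA1 hA2 hB0 hBs

end Sys

/-- A Hamilton cycle `q 0, q 1, ..., q N, q (N+1)` of `G`, with `y = q N` and `x = q (N+1)`. -/
structure Setup {V : Type} (G : SimpleGraph V) (N : ℕ) (q : ℕ → V) : Prop where
  inj : ∀ i j, i < N + 2 → j < N + 2 → q i = q j → i = j
  surj : ∀ v, ∃ i, i < N + 2 ∧ q i = v
  adj : ∀ i, i + 1 < N + 2 → G.Adj (q i) (q (i + 1))
  close : G.Adj (q (N + 1)) (q 0)

/-- There is a path of length `m` from `q u` to `q v` through vertices with index in `S`. -/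
def HP {V : Type} (G : SimpleGraph V) (q : ℕ → V) (u v : ℕ) (S : Set ℕ) (m : ℕ) : Prop :=
  ∃ w : G.Walk (q u) (q v), w.IsPath ∧ w.length = m ∧ ∀ z ∈ w.support, ∃ i ∈ S, q i = z

namespace Setup

variable {V : Type} {G : SimpleGraph V} {N : ℕ} {q : ℕ → V}

theorem hp_rev {u v m : ℕ} {S : Set ℕ} (h : HP G q u v S m) : HP G q v u S m := by
  obtain ⟨w, h1, h2, h3⟩ := h
  exact ⟨w.reverse, h1.reverse, by simpa using h2, by simpa using h3⟩

theorem hp_single (u : ℕ) : HP G q u u {u} 0 :=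
  ⟨Walk.nil, by simp, rfl, by simp⟩

theorem hp_join (H : Setup G N q) {a b c d m n : ℕ} {S T : Set ℕ} (h1 : HP G q a b S m)
    (h2 : HP G q c d T n) (hadj : G.Adj (q b) (q c))
    (hS : ∀ i ∈ S, i < N + 2) (hT : ∀ i ∈ T, i < N + 2) (hd : ∀ i ∈ S, i ∉ T) :
    HP G q a d (S ∪ T) (m + n + 1) := by
  obtain ⟨w, p1, l1, s1⟩ := h1
  obtain ⟨w', p2, l2, s2⟩ := h2
  refine ⟨w.append (Walk.cons hadj w'), ?_, ?_, ?_⟩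
  · rw [Walk.isPath_def, Walk.support_append, Walk.support_cons, List.tail_cons,
      List.nodup_append]
    refine ⟨p1.support_nodup, p2.support_nodup, ?_⟩
    rintro z hz z' hz' rfl
    obtain ⟨i, hi, rfl⟩ := s1 _ hz
    obtain ⟨j, hj, hij⟩ := s2 _ hz'
    have := H.inj j i (hT j hj) (hS i hi) hij
    subst this
    exact hd _ hi hj
  · simp [l1, l2]; omega
  · intro z hz
    rw [Walk.support_append, Walk.support_cons, List.tail_cons, List.mem_append] at hz
    rcases hz with hz | hz
    · obtain ⟨i, hi, h⟩ := s1 _ hz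
      exact ⟨i, Or.inl hi, h⟩
    · obtain ⟨i, hi, h⟩ := s2 _ hz
      exact ⟨i, Or.inr hi, h⟩

theorem hp_seg (H : Setup G N q) (i d : ℕ) (h : i + d < N + 2) :
    HP G q i (i + d) (Set.Icc i (i + d)) d := by
  induction d with
  | zero => simpa using hp_single (G := G) (q := q) i
  | succ d ih =>
    have := H.hp_join (ih (by omega)) (hp_single (i + d + 1)) (H.adj _ (by omega))
      (by intro j hj; simp at hj; omega) (by intro j hj; simp at hj; omega)
      (by intro j hj hj'; simp at hj hj'; omega)
    obtain ⟨w, h1, h2, h3⟩ := this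
    refine ⟨w, h1, h2, fun z hz => ?_⟩
    obtain ⟨j, hj, hz⟩ := h3 z hz
    refine ⟨j, ?_, hz⟩
    simp at hj ⊢
    omega

theorem hp_seg' (H : Setup G N q) {i j : ℕ} (hij : i ≤ j) (h : j < N + 2) :
    HP G q i j (Set.Icc i j) (j - i) := by
  have := H.hp_seg i (j - i) (by omega)
  rwa [show i + (j - i) = j by omega] at this

theorem hp_close {u v m : ℕ} {S : Set ℕ} (h : HP G q u v S m)
    (hm : 2 ≤ m) (hadj : G.Adj (q v) (q u)) : HasCycleLength G (m + 1) := by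
  obtain ⟨w, h1, h2, h3⟩ := h
  refine ⟨q v, Walk.cons hadj w, ?_, by simp [h2]⟩
  rw [Walk.cons_isCycle_iff]
  refine ⟨h1, fun he => ?_⟩
  have := h1.length_eq_one_of_mem_edges (by rwa [Sym2.eq_swap] at he)
  omega

/-- A path avoiding the vertices `x` and `y`, closed with the vertex `x` (index `e = N+1`)
or `y` (index `e = N`). -/
theorem cyc_one (H : Setup G N q) {u v m e : ℕ} {S : Set ℕ} (h : HP G q u v S m)
    (hS : ∀ i ∈ S, i < N) (he : e < N + 2) (heN : N ≤ e) (hm : 1 ≤ m)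
    (h1 : G.Adj (q e) (q u)) (h2 : G.Adj (q e) (q v)) : HasCycleLength G (m + 2) := by
  have := H.hp_join h (hp_single e) h2.symm (fun i hi => by have := hS i hi; omega)
    (by intro i hi; simp at hi; omega) (by intro i hi hi'; have := hS i hi; simp at hi'; omega)
  exact hp_close this (by omega) h1

/-- A path avoiding `x` and `y`, closed with the edge `xy`. -/
theorem cyc_edge (H : Setup G N q) {u v m : ℕ} {S : Set ℕ} (h : HP G q u v S m)
    (hS : ∀ i ∈ S, i < N) 
    (h1 : G.Adj (q (N + 1)) (q u)) (h2 : G.Adj (q N) (q v)) : HasCycleLength G (m + 3) := by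
  have := H.hp_join h (H.hp_seg' (i := N) (j := N + 1) (by omega) (by omega)) h2.symm
    (fun i hi => by have := hS i hi; omega)
    (by intro i hi; simp at hi; omega) (by intro i hi hi'; have := hS i hi; simp at hi'; omega)
  have := hp_close this (by omega) h1
  rwa [show m + (N + 1 - N) + 1 + 1 = m + 3 by omega] at this

/-- Two disjoint paths avoiding `x` and `y`, closed with `x` and `y`. -/
theorem cyc_two (H : Setup G N q) {u v m u' v' m' : ℕ} {S T : Set ℕ} (h : HP G q u v S m)
    (h' : HP G q u' v' T m')
    (hS : ∀ i ∈ S, i < N) (hT : ∀ i ∈ T, i < N) (hST : ∀ i ∈ S, i ∉ T)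
    (h1 : G.Adj (q (N + 1)) (q u)) (h2 : G.Adj (q N) (q v))
    (h1' : G.Adj (q (N + 1)) (q u')) (h2' : G.Adj (q N) (q v')) :
    HasCycleLength G (m + m' + 4) := by
  have a1 := H.hp_join h (hp_single N) h2.symm (fun i hi => by have := hS i hi; omega)
    (by intro i hi; simp at hi; omega) (by intro i hi hi'; have := hS i hi; simp at hi'; omega)
  have a2 := H.hp_join a1 (hp_rev h') h2'
    (by intro i hi; simp at hi; rcases hi with hi | hi
        · omega
        · have := hS i hi; omega)
    (fun i hi => by have := hT i hi; omega)
    (by intro i hi hi'; simp at hi; rcases hi with hi | hi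
        · have := hT i hi'; omega
        · exact hST i hi hi')
  have a3 := H.hp_join a2 (hp_single (N + 1)) h1'.symm
    (by intro i hi; simp at hi; rcases hi with (hi | hi) | hi
        · omega
        · have := hS i hi; omega
        · have := hT i hi; omega)
    (by intro i hi; simp at hi; omega)
    (by intro i hi hi'; simp at hi hi'; rcases hi with (hi | hi) | hi
        · omega
        · have := hS i hi; omega
        · have := hT i hi; omega)
  have := hp_close a3 (by omega) h1
  rwa [show m + 0 + 1 + m' + 1 + 0 + 1 + 1 = m + m' + 4 by omega] at this

/-- Two disjoint segments, each with one end adjacent to `x` and the other adjacent to `y`. -/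
theorem cyc_segs (H : Setup G N q) {i j k l : ℕ} (hij : i ≤ j) (hjk : j < k) (hkl : k ≤ l)
    (hl : l < N)
    (h : (G.Adj (q (N + 1)) (q i) ∧ G.Adj (q N) (q j)) ∨
      (G.Adj (q N) (q i) ∧ G.Adj (q (N + 1)) (q j)))
    (h' : (G.Adj (q (N + 1)) (q k) ∧ G.Adj (q N) (q l)) ∨
      (G.Adj (q N) (q k) ∧ G.Adj (q (N + 1)) (q l))) :
    HasCycleLength G (j - i + (l - k) + 4) := by
  have b1 := H.hp_seg' hij (by omega)
  have b2 := H.hp_seg' hkl (by omega)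
  have e1 : ∀ n ∈ Set.Icc i j, n < N := by intro n hn; simp at hn; omega
  have e2 : ∀ n ∈ Set.Icc k l, n < N := by intro n hn; simp at hn; omega
  have e3 : ∀ n ∈ Set.Icc i j, n ∉ Set.Icc k l := by intro n hn hn'; simp at hn hn'; omega
  rcases h with h | h <;> rcases h' with h' | h'
  · exact H.cyc_two b1 b2 e1 e2 e3 h.1 h.2 h'.1 h'.2
  · exact H.cyc_two b1 (hp_rev b2) e1 e2 e3 h.1 h.2 h'.2 h'.1
  · exact H.cyc_two (hp_rev b1) b2 e1 e2 e3 h.2 h.1 h'.1 h'.2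
  · exact H.cyc_two (hp_rev b1) (hp_rev b2) e1 e2 e3 h.2 h.1 h'.2 h'.1

theorem sys (H : Setup G N q) {s : ℕ} (hs : s + 3 ≤ N) (hno : ¬ HasCycleLength G (s + 3))
    (hcard : ∀ (a b : Finset ℕ), (∀ i, i ∈ a ↔ i < N ∧ G.Adj (q (N + 1)) (q i)) →
      (∀ i, i ∈ b ↔ i < N ∧ G.Adj (q N) (q i)) → N ≤ a.card + b.card) :
    Sys N s (fun i => G.Adj (q (N + 1)) (q i)) (fun i => G.Adj (q N) (q i)) := by
  classical
  have hbN : G.Adj (q N) (q (N - 1)) := by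
    have := H.adj (N - 1) (by omega)
    rw [show N - 1 + 1 = N by omega] at this
    exact this.symm
  have c1 : ∀ i, i + s < N → G.Adj (q (N + 1)) (q i) → ¬ G.Adj (q N) (q (i + s)) := by
    intro i hi h1 h2
    apply hno
    exact H.cyc_edge (H.hp_seg i s (by omega)) (by intro n hn; simp at hn; omega) h1 h2
  have c3 : ∀ c k l, G.Adj (q N) (q c) → c < k → k ≤ l → l < N → c + l + 1 = s + k →
      ¬ (G.Adj (q (N + 1)) (q k) ∧ G.Adj (q N) (q l)) ∧
      ¬ (G.Adj (q N) (q k) ∧ G.Adj (q (N + 1)) (q l)) := by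
    intro c k l h1 h2 h3 h4 h5
    rw [← not_or]
    intro h
    apply hno
    have := H.cyc_segs (Nat.zero_le c) h2 h3 h4 (Or.inl ⟨H.close, h1⟩) h
    rwa [show c - 0 + (l - k) + 4 = s + 3 by omega] at this
  set a := (Finset.range N).filter (fun i => G.Adj (q (N + 1)) (q i)) with ha
  set b := (Finset.range N).filter (fun i => G.Adj (q N) (q i)) with hb
  have hab := hcard a b (by intro i; simp [ha]) (by intro i; simp [hb])
  have key : ∀ i, i < N → ¬ G.Adj (q N) (q ((i + s) % N)) → G.Adj (q (N + 1)) (q i) := by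
    have hinj : Set.InjOn (fun i => (i + s) % N) (a : Set ℕ) := by
      intro i hi j hj hij
      simp [ha] at hi hj
      simp only at hij
      have := Nat.ModEq.add_right_cancel' s hij
      exact this.eq_of_lt_of_lt hi.1 hj.1
    have hsub : a.image (fun i => (i + s) % N) ⊆ (Finset.range N) \ b := by
      intro j hj
      rw [Finset.mem_image] at hj
      obtain ⟨i, hi, rfl⟩ := hj
      simp [ha] at hi
      rw [Finset.mem_sdiff, Finset.mem_range]
      refine ⟨Nat.mod_lt _ (by omega), ?_⟩
      intro h
      rw [hb, Finset.mem_filter] at h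
      by_cases hi2 : i + s < N
      · rw [Nat.mod_eq_of_lt hi2] at h
        exact c1 i hi2 hi.2 h.2
      · rw [Nat.mod_eq_sub_mod (by omega), Nat.mod_eq_of_lt (by omega)] at h
        exact (c3 (i + s - N) i (N - 1) h.2 (by omega) (by omega) (by omega) (by omega)).1
          ⟨hi.2, hbN⟩
    have hbsub : b ⊆ Finset.range N := Finset.filter_subset _ _
    have hc2 : ((Finset.range N) \ b).card = N - b.card := by
      rw [Finset.card_sdiff_of_subset hbsub, Finset.card_range]
    have heq := Finset.eq_of_subset_of_card_le hsub (by
      rw [Finset.card_image_of_injOn hinj, hc2]; omega)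
    intro i hi h
    have : (i + s) % N ∈ a.image (fun i => (i + s) % N) := by
      rw [heq, Finset.mem_sdiff, Finset.mem_range]
      refine ⟨Nat.mod_lt _ (by omega), ?_⟩
      intro h'
      rw [hb, Finset.mem_filter] at h'
      exact h h'.2
    rw [Finset.mem_image] at this
    obtain ⟨j, hj, hji⟩ := this
    simp [ha] at hj
    have := (Nat.ModEq.add_right_cancel' s hji).eq_of_lt_of_lt hj.1 hi
    rw [← this]; exact hj.2
  constructor
  · exact hs
  · exact H.close
  · exact hbN
  · exact c1
  · intro i hi h1 h2
    apply hno
    exact H.cyc_edge (hp_rev (H.hp_seg i s (by omega))) (by intro n hn; simp at hn; omega) h2 h1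
  · intro i hi h1 h2
    apply hno
    exact H.cyc_one (e := N + 1) (H.hp_seg i (s + 1) (by omega))
      (by intro n hn; simp at hn; omega) (by omega) (by omega) (by omega) h1 h2
  · intro i hi h1 h2
    apply hno
    exact H.cyc_one (e := N) (H.hp_seg i (s + 1) (by omega))
      (by intro n hn; simp at hn; omega) (by omega) (by omega) (by omega) h1 h2
  · exact c3
  · intro d k l h1 h2 h3 h4 h5
    rw [← not_or]
    intro h
    apply hno
    have := H.cyc_segs h2 h3 (show d ≤ N - 1 by omega) (by omega) h (Or.inl ⟨h1, hbN⟩)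
    rwa [show l - k + (N - 1 - d) + 4 = s + 3 by omega] at this
  · intro i hi h
    apply key i (by omega)
    rwa [Nat.mod_eq_of_lt hi]
  · intro e he h
    apply key _ (by omega)
    rwa [show e + N - s + s = e + N by omega, Nat.add_mod_right, Nat.mod_eq_of_lt (by omega)]
  · intro hd i hi
    have hdis : Disjoint a b := by
      rw [Finset.disjoint_left]
      intro j hj hj'
      simp [ha] at hj
      rw [hb, Finset.mem_filter] at hj'
      exact hd j hj.1 ⟨hj.2, hj'.2⟩
    have hu : a ∪ b = Finset.range N := by
      apply Finset.eq_of_subset_of_card_le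
      · exact Finset.union_subset (Finset.filter_subset _ _) (Finset.filter_subset _ _)
      · rw [Finset.card_union_of_disjoint hdis, Finset.card_range]; exact hab
    have : i ∈ a ∪ b := by rw [hu]; simpa using hi
    rw [Finset.mem_union, ha, hb, Finset.mem_filter, Finset.mem_filter] at this
    tauto

/-- Reversing the Hamilton cycle. -/
theorem reflect (H : Setup G N q) :
    Setup G N (fun i => if i < N then q (N - 1 - i) else if i = N then q (N + 1) else q N) := by
  constructor
  · intro i j hi hj h
    split_ifs at h <;> have := H.inj _ _ (by omega) (by omega) h <;> omega
  · intro v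
    obtain ⟨i, hi, rfl⟩ := H.surj v
    by_cases h1 : i < N
    · refine ⟨N - 1 - i, by omega, ?_⟩
      rw [if_pos (by omega)]; congr 1; omega
    · by_cases h2 : i = N
      · refine ⟨N + 1, by omega, ?_⟩
        simp [h2]
      · refine ⟨N, by omega, ?_⟩
        simp; congr 1; omega
  · intro i hi
    by_cases h1 : i + 1 < N
    · rw [if_pos (by omega), if_pos h1]
      have := H.adj (N - 1 - (i + 1)) (by omega)
      rw [show N - 1 - (i + 1) + 1 = N - 1 - i by omega] at this
      exact this.symm
    · by_cases h2 : i < N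
      · rw [if_pos h2, if_neg h1, if_pos (by omega), show N - 1 - i = 0 by omega]
        exact H.close.symm
      · rw [if_neg h2, if_pos (by omega), if_neg (by omega), if_neg (by omega)]
        exact (H.adj N (by omega)).symm
  · by_cases h : 0 < N
    · simp [h]
      have := H.adj (N - 1) (by omega)
      rw [show N - 1 + 1 = N by omega] at this
      exact this.symm
    · have : N = 0 := by omega
      subst this
      simpa using H.adj 0 (by omega)

/-- In the alternating situation a chord between even indices yields all odd cycles. -/
theorem even_chord (H : Setup G N q) (hN : N % 2 = 0)
    (hx : ∀ i, i < N → i % 2 = 0 → G.Adj (q (N + 1)) (q i))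
    (hy : ∀ i, i < N → i % 2 = 1 → G.Adj (q N) (q i))
    {i j : ℕ} (hij : i < j) (hj : j < N) (hi2 : i % 2 = 0) (hj2 : j % 2 = 0)
    (hadj : G.Adj (q i) (q j)) {k : ℕ} (hk3 : 3 ≤ k) (hk : k ≤ N) (hk2 : k % 2 = 1) :
    HasCycleLength G k := by
  have join : ∀ a l, a ≤ i → i < l → l ≤ j →
      HP G q a l (Set.Icc a i ∪ Set.Icc l j) (i - a + (j - l) + 1) := by
    intro a l h1 h2 h3
    exact H.hp_join (H.hp_seg' h1 (by omega)) (hp_rev (H.hp_seg' h3 (by omega))) hadj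
      (by intro n hn; simp at hn; omega) (by intro n hn; simp at hn; omega)
      (by intro n hn hn'; simp at hn hn'; omega)
  by_cases h1 : k ≤ j + 1
  · by_cases h2 : k ≤ j - i + 1
    · have := H.cyc_one (e := N + 1) (join i (j + 3 - k) (by omega) (by omega) (by omega))
        (by intro n hn; simp at hn; omega) (by omega) (by omega) (by omega)
        (hx _ (by omega) (by omega)) (hx _ (by omega) (by omega))
      rwa [show i - i + (j - (j + 3 - k)) + 1 + 2 = k by omega] at this
    · have := H.cyc_one (e := N + 1) (join (j + 1 - k) (i + 2) (by omega) (by omega) (by omega))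
        (by intro n hn; simp at hn; omega) (by omega) (by omega) (by omega)
        (hx _ (by omega) (by omega)) (hx _ (by omega) (by omega))
      rwa [show i - (j + 1 - k) + (j - (i + 2)) + 1 + 2 = k by omega] at this
  · have hp := join 0 (i + 1) (by omega) (by omega) (by omega)
    by_cases h2 : k = j + 3
    · have := H.cyc_edge hp (by intro n hn; simp at hn; omega)
        (hx _ (by omega) (by omega)) (hy _ (by omega) (by omega))
      rwa [show i - 0 + (j - (i + 1)) + 1 + 3 = k by omega] at this
    · have := H.cyc_two hp (H.hp_seg' (i := N - (k - j - 3)) (j := N - 1) (by omega) (by omega))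
        (by intro n hn; simp at hn; omega) (by intro n hn; simp at hn; omega)
        (by intro n hn hn'; simp at hn hn'; omega)
        (hx _ (by omega) (by omega)) (hy _ (by omega) (by omega))
        (hx _ (by omega) (by omega)) (hy _ (by omega) (by omega))
      rwa [show i - 0 + (j - (i + 1)) + 1 + (N - 1 - (N - (k - j - 3))) + 4 = k by omega] at this

theorem colorable (H : Setup G N q) {s : ℕ} (hs : s + 3 ≤ N)
    (hno : ¬ HasCycleLength G (s + 3))
    (hcard : ∀ (a b : Finset ℕ), (∀ i, i ∈ a ↔ i < N ∧ G.Adj (q (N + 1)) (q i)) →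
      (∀ i, i ∈ b ↔ i < N ∧ G.Adj (q N) (q i)) → N ≤ a.card + b.card) :
    G.Colorable 2 := by
  have S := H.sys hs hno hcard
  obtain ⟨hNE, hAB⟩ := S.alternate
  rw [Nat.even_iff] at hNE
  simp only [Nat.even_iff] at hAB
  -- `s` is even
  have hsE : s % 2 = 0 := by
    by_contra h
    exact S.c1 0 (by omega) S.a0 ((hAB _ (by omega)).2.2 (by omega))
  have main : ∀ i j, i < j → j < N + 2 → G.Adj (q i) (q j) → i % 2 ≠ j % 2 := by
    intro i j hij hj hadj hpar
    by_cases h1 : j = N + 1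
    · subst h1
      by_cases h2 : i = N
      · omega
      · have := (hAB i (by omega)).1.1 hadj.symm
        omega
    · by_cases h2 : j = N
      · subst h2
        have := (hAB i (by omega)).2.1 hadj.symm
        omega
      · by_cases h3 : i % 2 = 0
        · exact hno (H.even_chord hNE (fun n hn h => (hAB n hn).1.2 h)
            (fun n hn h => (hAB n hn).2.2 (by omega)) hij (by omega) h3 (by omega) hadj
            (by omega) (by omega) (by omega))
        · refine hno (H.reflect.even_chord (i := N - 1 - j) (j := N - 1 - i) hNE ?_ ?_ (by omega)
            (by omega) (by omega) (by omega) ?_ (by omega) (by omega) (by omega))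
          · intro n hn h
            simp [hn]
            exact (hAB _ (by omega)).2.2 (by omega)
          · intro n hn h
            simp [hn]
            exact (hAB _ (by omega)).1.2 (by omega)
          · rw [if_pos (by omega), if_pos (by omega),
              show N - 1 - (N - 1 - j) = j by omega, show N - 1 - (N - 1 - i) = i by omega]
            exact hadj.symm
  choose f hf hqf using H.surj
  refine ⟨Coloring.mk (fun v => (⟨f v % 2, by omega⟩ : Fin 2)) ?_⟩
  intro u v huv h
  have h1 : f u % 2 = f v % 2 := by simpa using h
  have hne : f u ≠ f v := by
    intro h2
    have : u = v := by rw [← hqf u, ← hqf v, h2]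
    exact huv.ne this
  rcases Nat.lt_or_gt_of_ne hne with h2 | h2
  · exact main _ _ h2 (hf v) (by rw [hqf, hqf]; exact huv) h1
  · exact main _ _ h2 (hf u) (by rw [hqf, hqf]; exact huv.symm) h1.symm

end Setup

theorem exists_setup {V : Type} [Fintype V] (G : SimpleGraph V) (x y : V) (c : G.Walk x x)
    (hc : c.IsCycle) (hspan : ∀ u : V, u ∈ c.support) (hy : c.snd = y) :
    ∃ N q, Setup G N q ∧ q (N + 1) = x ∧ q N = y ∧ Fintype.card V = N + 2 := by
  classical
  have h3 := hc.three_le_length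
  obtain ⟨N, hN⟩ : ∃ N, c.length = N + 2 := ⟨c.length - 2, by omega⟩
  have H : Setup G N (fun i => c.getVert (N + 1 - i)) := by
    constructor
    · intro i j hi hj h
      have := hc.getVert_injOn' (by simp only [Set.mem_ofPred_eq]; omega)
        (by simp only [Set.mem_ofPred_eq]; omega) h
      omega
    · intro v
      obtain ⟨n, hn, hnl⟩ := Walk.mem_support_iff_exists_getVert.mp (hspan v)
      by_cases h : n = N + 2
      · refine ⟨N + 1, by omega, ?_⟩
        rw [← hn, h, ← hN]
        simp
      · refine ⟨N + 1 - n, by omega, ?_⟩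
        rw [← hn]
        congr 1
        omega
    · intro i hi
      have := c.adj_getVert_succ (i := N + 1 - (i + 1)) (by omega)
      rw [show N + 1 - (i + 1) + 1 = N + 1 - i by omega] at this
      exact this.symm
    · have := c.adj_getVert_succ (i := N + 1) (by omega)
      rw [show N + 1 + 1 = c.length by omega] at this
      simpa using this.symm
  refine ⟨N, _, H, by simp, ?_, ?_⟩
  · rw [← hy]
    show c.getVert (N + 1 - N) = c.getVert 1
    congr 1
    omega
  · have h1 : (Finset.range (N + 2)).image (fun i => c.getVert (N + 1 - i)) = Finset.univ := by
      ext v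
      obtain ⟨i, hi, h⟩ := H.surj v
      simp only [Finset.mem_image, Finset.mem_range, Finset.mem_univ, iff_true]
      exact ⟨i, hi, h⟩
    rw [← Finset.card_univ, ← h1, Finset.card_image_of_injOn, Finset.card_range]
    intro i hi j hj h
    simp at hi hj
    exact H.inj i j hi hj h

theorem exists_setup' {V : Type} [Fintype V] (G : SimpleGraph V) (v x y : V) (c : G.Walk v v)
    (hc : c.IsCycle) (hspan : ∀ u : V, u ∈ c.support)
    (hdist : (c.toSubgraph.spanningCoe).dist x y = 1) :
    ∃ N q, Setup G N q ∧ q (N + 1) = x ∧ q N = y ∧ Fintype.card V = N + 2 := by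
  classical
  rw [SimpleGraph.dist_eq_one_iff_adj, Subgraph.spanningCoe_adj] at hdist
  have hx := hspan x
  have hc' : (c.rotate x hx).IsCycle := by simpa using hc
  have hs' : ∀ u, u ∈ (c.rotate x hx).support := by
    intro u
    rw [Walk.mem_support_rotate_iff]
    exact hspan u
  have hy : y ∈ (c.rotate x hx).toSubgraph.neighborSet x := by
    rw [Walk.toSubgraph_rotate]
    exact hdist
  rw [hc'.neighborSet_toSubgraph_endpoint] at hy
  rcases hy with hy | hy
  · exact exists_setup G x y _ hc' hs' hy.symm
  · refine exists_setup G x y _ hc'.reverse (by simpa using hs') ?_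
    rw [Walk.snd_reverse]
    exact hy.symm

theorem degree_bound {V : Type} [Fintype V] (G : SimpleGraph V) [DecidableRel G.Adj]
    {N : ℕ} {q : ℕ → V} (H : Setup G N q) (e f : ℕ) (hef : e + f = N + (N + 1))
    (he : e = N ∨ e = N + 1)
    (a : Finset ℕ) (ha : ∀ i, i ∈ a ↔ i < N ∧ G.Adj (q e) (q i)) :
    G.degree (q e) ≤ a.card + 1 := by
  classical
  have hsub : G.neighborFinset (q e) ⊆ insert (q f) (a.image q) := by
    intro v hv
    rw [mem_neighborFinset] at hv
    obtain ⟨i, hi, rfl⟩ := H.surj v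
    rw [Finset.mem_insert, Finset.mem_image]
    have hne : i ≠ e := by
      rintro rfl
      exact hv.ne rfl
    by_cases h : i < N
    · exact Or.inr ⟨i, (ha i).2 ⟨h, hv⟩, rfl⟩
    · left
      congr 1
      omega
  rw [← card_neighborFinset_eq_degree]
  calc _ ≤ _ := Finset.card_le_card hsub
    _ ≤ (a.image q).card + 1 := Finset.card_insert_le _ _
    _ ≤ a.card + 1 := by
      have := Finset.card_image_le (s := a) (f := q)
      omega

theorem pancyclic_or_bipartite_of_hamiltonian_consecutive_pair {V : Type} [Fintype V]
    (G : SimpleGraph V) [DecidableRel G.Adj]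
    (v : V) (c : G.Walk v v) (hc : c.IsCycle) (hspan : ∀ u : V, u ∈ c.support)
    (x y : V) (hdist : (c.toSubgraph.spanningCoe).dist x y = 1)
    (hdeg : Fintype.card V ≤ G.degree x + G.degree y) :
    IsPancyclic G ∨ G.Colorable 2 ∨
      (∀ k : ℕ, 3 ≤ k → k ≤ Fintype.card V → k ≠ Fintype.card V - 1 →
        HasCycleLength G k) := by
  classical
  obtain ⟨N, q, H, hqx, hqy, hcardV⟩ := exists_setup' G v x y c hc hspan hdist
  right
  by_contra hcon
  push Not at hcon
  obtain ⟨hcol, k, hk3, hkn, hk1, hno⟩ := hcon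
  have hkne : k ≠ N + 2 := by
    rintro rfl
    apply hno
    have := Setup.hp_close (H.hp_seg' (i := 0) (j := N + 1) (by omega) (by omega)) (by omega)
      H.close
    exact this
  obtain ⟨s, rfl⟩ : ∃ s, k = s + 3 := ⟨k - 3, by omega⟩
  apply hcol
  apply H.colorable (s := s) (by omega) hno
  intro a b ha hb
  have h1 := degree_bound G H (N + 1) N (by omega) (by omega) a ha
  have h2 := degree_bound G H N (N + 1) (by omega) (by omega) b hb
  rw [hqx] at h1
  rw [hqy] at h2
  omega
end

section
/- Let G be a graph on n vertices with a Hamilton cycle C. If there exist two vertices x, y of G at distance 2 along C (i.e., d_C(x,y) = 2) satisfying d(x) + d(y) ≥ n + 1, then G is pancyclic. -/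
open SimpleGraph

theorem aux_walk {V : Type} (G : SimpleGraph V) (f : ℕ → V) (l : ℕ)
    (h : ∀ i < l, G.Adj (f i) (f (i+1))) :
    ∃ w : G.Walk (f 0) (f l), w.length = l ∧ w.support = (List.range (l+1)).map f := by
  induction l with
  | zero => exact ⟨Walk.nil, rfl, by simp⟩
  | succ l ih =>
    obtain ⟨w, h1, h2⟩ := ih (fun i hi => h i (by omega))
    refine ⟨w.concat (h l (by omega)), by simp [h1], ?_⟩
    rw [Walk.support_concat, h2, List.range_succ (n := l+1)]
    simp

theorem aux_cycle {V : Type} (G : SimpleGraph V) (f : ℕ → V) (k : ℕ) (hk : 3 ≤ k)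
    (hinj : ∀ i j, i < k → j < k → f i = f j → i = j)
    (h : ∀ i, i + 1 < k → G.Adj (f i) (f (i+1))) (hc : G.Adj (f (k-1)) (f 0)) :
    HasCycleLength G k := by
  obtain ⟨w, h1, h2⟩ := aux_walk G f (k-1) (fun i hi => h i (by omega))
  have hp : w.IsPath := by
    rw [Walk.isPath_def, h2, List.nodup_map_iff_inj_on List.nodup_range]
    intro a ha b hb hab
    simp at ha hb
    exact hinj a b (by omega) (by omega) hab
  refine ⟨_, Walk.cons hc w, ?_, by simp [h1]; omega⟩
  rw [Walk.cons_isCycle_iff]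
  refine ⟨hp, fun hm => ?_⟩
  have := hp.length_eq_one_of_mem_edges (by rwa [Sym2.eq_swap] at hm)
  omega

theorem aux_count (A B : ℕ → ℕ) (d e : ℕ) :
    ∑ i ∈ Finset.Ico 2 (d+e+2), A i + ∑ i ∈ Finset.Ico 2 (d+e+2), B i =
    ∑ i ∈ Finset.Ico 2 (d+2), (A i + B (i+e)) + ∑ i ∈ Finset.Ico 2 (e+2), (A (i+d) + B i) := by
  rw [Finset.sum_add_distrib, Finset.sum_add_distrib, Finset.sum_Ico_add' A, Finset.sum_Ico_add' B,
    ← Finset.sum_Ico_consecutive A (show 2 ≤ d+2 by omega) (show d+2 ≤ d+e+2 by omega),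
    ← Finset.sum_Ico_consecutive B (show 2 ≤ e+2 by omega) (show e+2 ≤ d+e+2 by omega)]
  rw [show 2+e = e+2 by omega, show 2+d = d+2 by omega, show d+2+e = d+e+2 by omega,
    show e+2+d = d+e+2 by omega]
  omega

structure HamSeq {V : Type} (G : SimpleGraph V) (q : ℕ → V) (m : ℕ) : Prop where
  inj : ∀ i j, i ≤ m → j ≤ m → q i = q j → i = j
  adj : ∀ i, i < m → G.Adj (q i) (q (i+1))
  close : G.Adj (q m) (q 0)
  surj : ∀ v, ∃ i, i ≤ m ∧ q i = v

theorem HamSeq.cyc {V : Type} {G : SimpleGraph V} {q : ℕ → V} {m : ℕ} (H : HamSeq G q m)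
    (g : ℕ → ℕ) (k : ℕ) (hk : 3 ≤ k) (hg : ∀ i < k, g i ≤ m)
    (hinj : ∀ i j, i < k → j < k → g i = g j → i = j)
    (h : ∀ i, i + 1 < k → G.Adj (q (g i)) (q (g (i+1)))) (hc : G.Adj (q (g (k-1))) (q (g 0))) :
    HasCycleLength G k :=
  aux_cycle G (fun i => q (g i)) k hk
    (fun i j hi hj e => hinj i j hi hj (H.inj _ _ (hg i hi) (hg j hj) e)) h hc

theorem HamSeq.adj' {V : Type} {G : SimpleGraph V} {q : ℕ → V} {m : ℕ} (H : HamSeq G q m)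
    (i j : ℕ) (h : (j = i + 1 ∧ i < m) ∨ (i = j + 1 ∧ j < m)) : G.Adj (q i) (q j) := by
  rcases h with ⟨rfl, h⟩ | ⟨rfl, h⟩
  · exact H.adj _ h
  · exact (H.adj _ h).symm

/-- crossing cycle -/
theorem HamSeq.c1 {V : Type} {G : SimpleGraph V} {q : ℕ → V} {m : ℕ} (H : HamSeq G q m)
    (i j : ℕ) (hi : 2 ≤ i) (hij : i < j) (hj : j < m) (hx : G.Adj (q m) (q i))
    (hy : G.Adj (q 1) (q j)) : HasCycleLength G (i + m - j + 1) := by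
  apply H.cyc (fun t => if t < i then t + 1 else m + i - t) _ (by omega)
  · intro t ht; split_ifs <;> omega
  · intro t s ht hs; split_ifs <;> omega
  · intro t ht
    by_cases h : t + 1 < i
    · rw [if_pos (by omega), if_pos h]; exact H.adj' _ _ (by omega)
    · by_cases h' : t < i
      · rw [if_pos h', if_neg h, show t + 1 = i by omega, show m + i - i = m by omega]
        exact hx.symm
      · rw [if_neg h', if_neg h]; exact H.adj' _ _ (by omega)
  · rw [if_neg (by omega), if_pos (by omega), show m + i - (i + m - j + 1 - 1) = j by omega]
    exact hy.symm

/-- cycle through z -/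
theorem HamSeq.c2 {V : Type} {G : SimpleGraph V} {q : ℕ → V} {m : ℕ} (H : HamSeq G q m)
    (i j : ℕ) (hj : 2 ≤ j) (hij : j ≤ i) (hi : i < m) (hx : G.Adj (q m) (q i))
    (hy : G.Adj (q 1) (q j)) : HasCycleLength G (i - j + 4) := by
  apply H.cyc (fun t => if t = 0 then m else if t < 3 then t - 1 else j + t - 3) _ (by omega)
  · intro t ht; split_ifs <;> omega
  · intro t s ht hs; split_ifs <;> omega
  · intro t ht
    rcases Nat.lt_or_ge t 3 with h | h
    · interval_cases t
      · exact H.close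
      · exact H.adj 0 (by omega)
      · simpa using hy
    · rw [if_neg (by omega), if_neg (by omega), if_neg (by omega), if_neg (by omega)]
      exact H.adj' _ _ (by omega)
  · rw [if_neg (by omega), if_neg (by omega), if_pos rfl, show j + (i-j+4-1) - 3 = i by omega]
    exact hx.symm

/-- cycle through the edge xy -/
theorem HamSeq.c3 {V : Type} {G : SimpleGraph V} {q : ℕ → V} {m : ℕ} (H : HamSeq G q m)
    (i j : ℕ) (hj : 2 ≤ j) (hij : j ≤ i) (hi : i < m) (hx : G.Adj (q m) (q i))
    (hy : G.Adj (q 1) (q j)) (hxy : G.Adj (q m) (q 1)) : HasCycleLength G (i - j + 3) := by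
  apply H.cyc (fun t => if t = 0 then m else if t < 2 then t else j + t - 2) _ (by omega)
  · intro t ht; split_ifs <;> omega
  · intro t s ht hs; split_ifs <;> omega
  · intro t ht
    rcases Nat.lt_or_ge t 2 with h | h
    · interval_cases t
      · simpa using hxy
      · simpa using hy
    · rw [if_neg (by omega), if_neg (by omega), if_neg (by omega), if_neg (by omega)]
      exact H.adj' _ _ (by omega)
  · rw [if_neg (by omega), if_neg (by omega), if_pos rfl, show j + (i-j+3-1) - 2 = i by omega]
    exact hx.symm

/-- cycle with one apex -/
theorem HamSeq.c5 {V : Type} {G : SimpleGraph V} {q : ℕ → V} {m : ℕ} (H : HamSeq G q m)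
    (a i j : ℕ) (ha : a ≤ m) (hij : i < j) (hi : j ≤ m) (hai : a < i ∨ j < a)
    (hx : G.Adj (q a) (q i))
    (hy : G.Adj (q a) (q j)) : HasCycleLength G (j - i + 2) := by
  apply H.cyc (fun t => if t = 0 then a else i + t - 1) _ (by omega)
  · intro t ht; split_ifs <;> omega
  · intro t s ht hs; split_ifs <;> omega
  · intro t ht
    rcases Nat.lt_or_ge t 1 with h | h
    · interval_cases t
      simpa using hx
    · rw [if_neg (by omega), if_neg (by omega)]
      exact H.adj' _ _ (by omega)
  · rw [if_neg (by omega), if_pos rfl, show i + (j-i+2-1) - 1 = j by omega]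
    exact hy.symm

theorem HamSeq.deg {V : Type} [Fintype V] {G : SimpleGraph V} [DecidableRel G.Adj]
    {q : ℕ → V} {m : ℕ} (H : HamSeq G q m) (v : V) :
    G.degree v = ∑ i ∈ Finset.range (m+1), if G.Adj v (q i) then 1 else 0 := by
  classical
  rw [← Finset.card_filter, ← SimpleGraph.card_neighborFinset_eq_degree]
  symm
  apply Finset.card_bij (fun i _ => q i)
  · intro i hi; simpa using (Finset.mem_filter.1 hi).2
  · intro i hi j hj h
    simp at hi hj
    exact H.inj i j (by omega) (by omega) h
  · intro b hb
    obtain ⟨i, hi, rfl⟩ := H.surj b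
    exact ⟨i, by simp at hb ⊢; exact ⟨by omega, hb⟩, rfl⟩

theorem aux_split (A : ℕ → ℕ) (m : ℕ) (hm : 2 ≤ m) :
    ∑ i ∈ Finset.range (m+1), A i = A 0 + A 1 + ∑ i ∈ Finset.Ico 2 m, A i + A m := by
  rw [Finset.sum_range_succ, ← Finset.sum_range_add_sum_Ico A hm]
  simp [Finset.sum_range_succ]

theorem HamSeq.tri {V : Type} [Fintype V] {G : SimpleGraph V} [DecidableRel G.Adj]
    {q : ℕ → V} {m : ℕ} (H : HamSeq G q m)
    (hno : ¬ HasCycleLength G 3) (v : V) : 2 * G.degree v ≤ m + 1 := by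
  have tri : ∀ a b c, G.Adj a b → G.Adj b c → G.Adj c a → False := by
    intro a b c hab hbc hca
    exact hno ⟨a, Walk.cons hab (Walk.cons hbc (Walk.cons hca Walk.nil)), by
      simp [Walk.cons_isCycle_iff, hab.ne, hbc.ne, hca.ne, hab.ne.symm,
        hca.ne.symm], rfl⟩
  have h1 := H.deg v
  have h2 := h1
  rw [Finset.sum_range_succ] at h1
  rw [Finset.sum_range_succ'] at h2
  have h3 : ∑ i ∈ Finset.range m, ((if G.Adj v (q i) then 1 else 0) +
      (if G.Adj v (q (i+1)) then 1 else 0)) ≤ ∑ i ∈ Finset.range m, 1 := by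
    apply Finset.sum_le_sum
    intro i hi
    split_ifs with ha hb <;> try omega
    exact (tri _ _ _ ha (H.adj i (Finset.mem_range.1 hi)) hb.symm).elim
  have h4 : (if G.Adj v (q m) then 1 else 0) + (if G.Adj v (q 0) then 1 else 0) ≤ 1 := by
    split_ifs with ha hb <;> try omega
    exact (tri _ _ _ ha H.close hb.symm).elim
  rw [Finset.sum_add_distrib] at h3
  simp only [Finset.sum_const, Finset.card_range, smul_eq_mul, mul_one] at h3
  omega

theorem HamSeq.main1 {V : Type} [Fintype V] {G : SimpleGraph V} [DecidableRel G.Adj]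
    {q : ℕ → V} {d e : ℕ} (H : HamSeq G q (d+e+2)) (he : 1 ≤ e) (hd : 1 ≤ d)
    (hdeg : d + e + 2 + 2 ≤ G.degree (q (d+e+2)) + G.degree (q 1))
    (hno : ¬ HasCycleLength G (d+3)) :
    G.Adj (q (d+e+2)) (q 1) ∧ G.Adj (q (d+e+2)) (q 2) ∧
      G.Adj (q 1) (q (d+e+1)) ∧ ∀ j, 2 ≤ j → j < e + 2 → ¬ G.Adj (q (d+e+2)) (q (j+d)) →
        G.Adj (q 1) (q j) := by
  rw [H.deg, H.deg, aux_split _ _ (by omega), aux_split _ _ (by omega)] at hdeg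
  have h10 : G.Adj (q 1) (q 0) := (H.adj 0 (by omega)).symm
  have hy2 : G.Adj (q 1) (q 2) := H.adj 1 (by omega)
  have hxm : G.Adj (q (d+e+2)) (q (d+e+1)) := (H.adj (d+e+1) (by omega)).symm
  rw [if_pos H.close, if_pos h10, if_neg (G.irrefl), if_neg (G.irrefl)] at hdeg
  obtain ⟨A, hA⟩ : ∃ A : ℕ → ℕ, A = fun i => if G.Adj (q (d+e+2)) (q i) then 1 else 0 := ⟨_, rfl⟩
  obtain ⟨B, hB⟩ : ∃ B : ℕ → ℕ, B = fun i => if G.Adj (q 1) (q i) then 1 else 0 := ⟨_, rfl⟩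
  have key := aux_count A B d e
  have hA1 : ∀ i, A i ≤ 1 := by intro i; rw [hA]; dsimp only; split_ifs <;> omega
  have hB1 : ∀ i, B i ≤ 1 := by intro i; rw [hB]; dsimp only; split_ifs <;> omega
  have hA' : ∀ i, A i = 1 ↔ G.Adj (q (d+e+2)) (q i) := by
    intro i; rw [hA]; dsimp only; split_ifs with h <;> simp [h]
  have hB' : ∀ i, B i = 1 ↔ G.Adj (q 1) (q i) := by
    intro i; rw [hB]; dsimp only; split_ifs with h <;> simp [h]
  have hdeg : d + e + 2 + 2 ≤ 1 + A 1 + ∑ i ∈ Finset.Ico 2 (d+e+2), A i + 0 +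
    (1 + 0 + ∑ i ∈ Finset.Ico 2 (d+e+2), B i + B (d+e+2)) := by
    rw [hA, hB]; exact hdeg
  clear hA hB
  have hAB : A 1 = B (d+e+2) := by
    have h1 := hA' 1
    have h2 := hB' (d+e+2)
    rw [SimpleGraph.adj_comm] at h2
    have := hA1 1
    have := hB1 (d+e+2)
    by_cases h : G.Adj (q (d+e+2)) (q 1)
    · rw [h1.2 h, h2.2 h]
    · have := mt h1.1 h
      have := mt h2.1 h
      omega
  have f1 : ∀ i ∈ Finset.Ico 2 (d+2), A i + B (i+e) ≤ 1 := by
    intro i hi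
    rw [Finset.mem_Ico] at hi
    have := hA1 i
    have := hB1 (i+e)
    by_contra hcon
    apply hno
    have := H.c1 i (i+e) (by omega) (by omega) (by omega) ((hA' _).1 (by omega))
      ((hB' _).1 (by omega))
    rwa [show i + (d+e+2) - (i+e) + 1 = d + 3 by omega] at this
  have f2 : ∀ i, 1 ≤ i → i < e + 2 → A (i+d) + B (i+1) ≤ 1 := by
    intro i hi hi'
    have := hA1 (i+d)
    have := hB1 (i+1)
    by_contra hcon
    apply hno
    have := H.c2 (i+d) (i+1) (by omega) (by omega) (by omega) ((hA' _).1 (by omega))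
      ((hB' _).1 (by omega))
    rwa [show i + d - (i+1) + 4 = d + 3 by omega] at this
  have s1 := Finset.sum_le_sum f1
  simp only [Finset.sum_const, Nat.card_Ico, smul_eq_mul, mul_one] at s1
  have hxy : G.Adj (q (d+e+2)) (q 1) := by
    by_contra hcon
    have hA0 : A 1 = 0 := by
      have := mt (hA' 1).1 hcon
      have := hA1 1
      omega
    have s2 : ∑ i ∈ Finset.Ico 2 (e+2), (A (i+d) + B (i+1)) ≤ ∑ i ∈ Finset.Ico 2 (e+2), 1 := by
      apply Finset.sum_le_sum
      intro i hi
      rw [Finset.mem_Ico] at hi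
      exact f2 i (by omega) (by omega)
    simp only [Finset.sum_const, Nat.card_Ico, smul_eq_mul, mul_one] at s2
    rw [Finset.sum_add_distrib, Finset.sum_Ico_add' B] at s2
    rw [Finset.sum_add_distrib (f := fun i => A (i+d)) (g := fun i => B i)] at key
    have h3 := Finset.sum_eq_sum_Ico_succ_bot (show 2 < e + 2 + 1 by omega) B
    have h4 := Finset.sum_Ico_succ_top (show 2 ≤ e + 2 by omega) B
    have := hB1 2
    omega
  have hA11 := (hA' 1).2 hxy
  have f3 : ∀ i ∈ Finset.Ico 2 (e+2), A (i+d) + B i ≤ 1 := by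
    intro i hi
    rw [Finset.mem_Ico] at hi
    have := hA1 (i+d)
    have := hB1 i
    by_contra hcon
    apply hno
    have := H.c3 (i+d) i (by omega) (by omega) (by omega) ((hA' _).1 (by omega))
      ((hB' _).1 (by omega)) hxy
    rwa [show i + d - i + 3 = d + 3 by omega] at this
  have s3 := Finset.sum_le_sum f3
  simp only [Finset.sum_const, Nat.card_Ico, smul_eq_mul, mul_one] at s3
  have e1 := (Finset.sum_eq_sum_iff_of_le f1).1 (by
    simp only [Finset.sum_const, Nat.card_Ico, smul_eq_mul, mul_one]; omega)
  have e3 := (Finset.sum_eq_sum_iff_of_le f3).1 (by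
    simp only [Finset.sum_const, Nat.card_Ico, smul_eq_mul, mul_one]; omega)
  have hB2 := (hB' 2).2 hy2
  have hAm := (hA' _).2 hxm
  refine ⟨hxy, (hA' _).1 ?_, (hB' _).1 ?_, ?_⟩
  · have h1 := e1 2 (by rw [Finset.mem_Ico]; omega)
    have h2 := f2 (e+1) (by omega) (by omega)
    rw [show e + 1 + d = d + e + 1 by omega, show e + 1 + 1 = 2 + e by omega] at h2
    omega
  · have h1 := e1 (d+1) (by rw [Finset.mem_Ico]; omega)
    have h2 := f2 1 (by omega) (by omega)
    rw [show 1 + d = d + 1 by omega, show 1 + 1 = 2 from rfl] at h2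
    rw [show d + e + 1 = d + 1 + e by omega]
    omega
  · intro j hj hj' hn
    have h1 := e3 j (by rw [Finset.mem_Ico]; omega)
    have h2 := mt (hA' (j+d)).1 hn
    have := hA1 (j+d)
    exact (hB' _).1 (by omega)

theorem HamSeq.main2 {V : Type} [Fintype V] {G : SimpleGraph V} [DecidableRel G.Adj]
    {q : ℕ → V} {d e : ℕ} (H : HamSeq G q (d+e+2)) (he : 1 ≤ e) (hd : 1 ≤ d)
    (hdeg : d + e + 2 + 2 ≤ G.degree (q (d+e+2)) + G.degree (q 1)) :
    HasCycleLength G (d+3) := by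
  by_contra hno
  obtain ⟨hxy, hx2, hym, hp⟩ := H.main1 he hd hdeg hno
  have hy2 : G.Adj (q 1) (q 2) := H.adj 1 (by omega)
  have hxm : G.Adj (q (d+e+2)) (q (d+e+1)) := (H.adj (d+e+1) (by omega)).symm
  obtain ⟨q', hq'⟩ : ∃ q' : ℕ → V, q' = fun i => if i = 1 then q (d+e+2) else
    if i = d+e+2 then q 1 else q i := ⟨_, rfl⟩
  have q1 : q' 1 = q (d+e+2) := by rw [hq']; simp
  have qm : q' (d+e+2) = q 1 := by rw [hq']; simp
  have qq : ∀ i, i ≠ 1 → i ≠ d+e+2 → q' i = q i := by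
    intro i h1 h2; rw [hq']; simp [h1, h2]
  have H' : HamSeq G q' (d+e+2) := by
    refine ⟨?_, ?_, ?_, ?_⟩
    · intro i j hi hj hij
      rw [hq'] at hij
      dsimp only at hij
      split_ifs at hij <;> have := H.inj _ _ (by omega) (by omega) hij <;> omega
    · intro i hi
      rcases Nat.eq_zero_or_pos i with rfl | h0
      · rw [q1, qq 0 (by omega) (by omega)]; exact H.close.symm
      · rcases Nat.lt_or_ge 1 i with h1 | h1
        · rw [qq i (by omega) (by omega)]
          by_cases h2 : i + 1 = d + e + 2
          · rw [h2, qm, show i = d+e+1 by omega]; exact hym.symm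
          · rw [qq _ (by omega) h2]; exact H.adj i hi
        · obtain rfl : i = 1 := by omega
          rw [q1, qq _ (by omega) (by omega)]; exact hx2
    · rw [qm, qq 0 (by omega) (by omega)]; exact (H.adj 0 (by omega)).symm
    · intro v
      obtain ⟨i, hi, rfl⟩ := H.surj v
      by_cases h1 : i = 1
      · exact ⟨d+e+2, le_rfl, by rw [qm, h1]⟩
      · by_cases h2 : i = d+e+2
        · exact ⟨1, by omega, by rw [q1, h2]⟩
        · exact ⟨i, hi, qq i h1 h2⟩
  obtain ⟨-, -, -, hp'⟩ := H'.main1 he hd (by rw [q1, qm]; omega) hno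
  rw [q1, qm] at hp'
  have claim : ∀ s, 2 ≤ s → s < e + 2 →
      ¬ (G.Adj (q (d+e+2)) (q (s+d)) ∧ G.Adj (q 1) (q (s+d))) := by
    intro s hs
    induction s, hs using Nat.le_induction with
    | base =>
      rintro - ⟨h, -⟩
      apply hno
      have := H.c3 (2+d) 2 (by omega) (by omega) (by omega) h hy2 hxy
      rwa [show 2 + d - 2 + 3 = d + 3 by omega] at this
    | succ s hs ih =>
      rintro hs' ⟨ha, hb⟩
      apply ih (by omega)
      constructor
      · by_contra h
        have h1 := hp s hs (by omega) h
        have := H.c5 1 s (s+1+d) (by omega) (by omega) (by omega) (by omega) h1 hb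
        rw [show s + 1 + d - s + 2 = d + 3 by omega] at this
        exact hno this
      · by_contra h
        have h1 := hp' s hs (by omega) (by rwa [qq _ (by omega) (by omega)])
        rw [qq _ (by omega) (by omega)] at h1
        have := H.c5 (d+e+2) s (s+1+d) (by omega) (by omega) (by omega) (by omega) h1 ha
        rw [show s + 1 + d - s + 2 = d + 3 by omega] at this
        exact hno this
  refine claim (e+1) (by omega) (by omega) ?_
  rw [show e + 1 + d = d + e + 1 by omega]
  exact ⟨hxm, hym⟩

theorem HamSeq.main {V : Type} [Fintype V] {G : SimpleGraph V} [DecidableRel G.Adj]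
    {q : ℕ → V} {m : ℕ} (H : HamSeq G q m)
    (hdeg : m + 2 ≤ G.degree (q m) + G.degree (q 1)) (k : ℕ) (hk : 3 ≤ k) (hkm : k ≤ m + 1) :
    HasCycleLength G k := by
  by_cases h1 : k = m + 1
  · subst h1
    apply H.cyc (fun t => t) _ hk (by intros; omega) (by intros; omega)
      (fun i hi => H.adj i (by omega))
    simpa using H.close
  · by_cases h3 : k = 3
    · subst h3
      by_contra hno
      have := H.tri hno (q m)
      have := H.tri hno (q 1)
      omega
    · obtain ⟨d, rfl⟩ : ∃ d, k = d + 3 := ⟨k - 3, by omega⟩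
      obtain ⟨e, rfl⟩ : ∃ e, m = d + e + 2 := ⟨m - d - 2, by omega⟩
      exact H.main2 (by omega) (by omega) hdeg

theorem HamSeq.ofCycle {V : Type} {G : SimpleGraph V} (z : V) (c : G.Walk z z)
    (hc : c.IsCycle) (hspan : ∀ u : V, u ∈ c.support) : HamSeq G c.getVert (c.length - 1) := by
  have h3 := hc.three_le_length
  refine ⟨?_, ?_, ?_, ?_⟩
  · intro i j hi hj h
    exact hc.getVert_injOn' hi hj h
  · intro i hi
    exact c.adj_getVert_succ (by omega)
  · have := c.adj_getVert_succ (i := c.length - 1) (by omega)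
    rw [show c.length - 1 + 1 = c.length by omega, Walk.getVert_length] at this
    rwa [Walk.getVert_zero]
  · intro v
    obtain ⟨i, hi, hl⟩ := Walk.mem_support_iff_exists_getVert.1 (hspan v)
    by_cases h : i = c.length
    · exact ⟨0, by omega, by rw [← hi, h]; simp⟩
    · exact ⟨i, by omega, hi⟩

theorem HamSeq.card {V : Type} [Fintype V] {G : SimpleGraph V} {q : ℕ → V} {m : ℕ}
    (H : HamSeq G q m) : Fintype.card V = m + 1 := by
  rw [← Finset.card_univ, ← Finset.card_range (m+1)]
  symm
  apply Finset.card_bij (fun i _ => q i)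
  · intro i hi; simp
  · intro i hi j hj h
    simp at hi hj
    exact H.inj i j (by omega) (by omega) h
  · intro b hb
    obtain ⟨i, hi, rfl⟩ := H.surj b
    exact ⟨i, by simp; omega, rfl⟩

theorem pancyclic_aux {V : Type} [Fintype V]
    (G : SimpleGraph V) [DecidableRel G.Adj] (z : V) (c : G.Walk z z)
    (hc : c.IsCycle) (hspan : ∀ u : V, u ∈ c.support)
    (hdeg : Fintype.card V + 1 ≤ G.degree c.snd + G.degree c.penultimate) : IsPancyclic G := by
  have H := HamSeq.ofCycle z c hc hspan
  have hcard := H.card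
  intro k hk hkn
  refine H.main ?_ k hk (by omega)
  change _ ≤ G.degree c.penultimate + G.degree c.snd
  omega

theorem pancyclic_of_hamiltonian_distance_two_heavy_pair {V : Type} [Fintype V]
    (G : SimpleGraph V) [DecidableRel G.Adj]
    (v : V) (c : G.Walk v v) (hc : c.IsCycle) (hspan : ∀ u : V, u ∈ c.support)
    (x y : V) (hdist : (c.toSubgraph.spanningCoe).dist x y = 2)
    (hdeg : Fintype.card V + 1 ≤ G.degree x + G.degree y) :
    IsPancyclic G := by
  classical
  obtain ⟨w, hw⟩ := exists_walk_of_dist_ne_zero (by rw [hdist]; omega : _ ≠ 0)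
  rw [hdist] at hw
  have hxy : x ≠ y := by
    rintro rfl
    simp at hdist
  obtain ⟨z, hxz, hzy⟩ : ∃ z, c.toSubgraph.Adj z x ∧ c.toSubgraph.Adj z y := by
    have h0 := w.adj_getVert_succ (i := 0) (by omega)
    have h1 := w.adj_getVert_succ (i := 1) (by omega)
    have h2 := w.getVert_length
    rw [hw] at h2
    rw [Walk.getVert_zero] at h0
    rw [show 1 + 1 = 2 from rfl, h2] at h1
    exact ⟨_, Subgraph.Adj.symm (by simpa using h0), by simpa using h1⟩
  have hz := hspan z
  have hc' := hc.rotate hz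
  have hn := hc'.neighborSet_toSubgraph_endpoint
  rw [Walk.toSubgraph_rotate] at hn
  have hx : x ∈ c.toSubgraph.neighborSet z := hxz
  have hy : y ∈ c.toSubgraph.neighborSet z := hzy
  rw [hn] at hx hy
  have hs : ∀ u : V, u ∈ (c.rotate z hz).support := by
    intro u
    rw [← Walk.mem_verts_toSubgraph, Walk.toSubgraph_rotate, Walk.mem_verts_toSubgraph]
    exact hspan u
  refine pancyclic_aux G z _ hc' hs ?_
  rcases hx with hx | hx <;> rcases hy with hy | hy
  · exact absurd (hx.trans hy.symm) hxy
  · rw [← hx, ← hy]; exact hdeg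
  · rw [← hx, ← hy]; omega
  · exact absurd (hx.trans hy.symm) hxy
end

section
/- Let G be a 2-connected graph which is not a cycle. If G contains no induced subgraph isomorphic to K_{1,3} and no induced subgraph isomorphic to P_4, then G is pancyclic. -/
open SimpleGraph

/-- The list `u :: t` is a closed cyclic sequence of distinct vertices. -/
def CycList {V : Type} (G : SimpleGraph V) (u : V) (t : List V) : Prop :=
  (u :: t).Nodup ∧ List.IsChain G.Adj (u :: t ++ [u])

/-- There is a cyclic list one longer than `t` suggests. -/
def ExtList {V : Type} (G : SimpleGraph V) (t : List V) : Prop :=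
  ∃ (u' : V) (t' : List V), CycList G u' t' ∧ t'.length = t.length + 1

theorem no_P4 {V : Type} {G : SimpleGraph V} (hP4 : RFree G (pathGraph 4)) {a b c d : V}
    (hab : G.Adj a b) (hbc : G.Adj b c) (hcd : G.Adj c d) :
    G.Adj a c ∨ G.Adj b d ∨ G.Adj a d := by
  by_contra! h
  obtain ⟨h1, h2, h3⟩ := h
  have e1 : a ≠ c := by rintro rfl; exact h3 hcd
  have e2 : b ≠ d := by rintro rfl; exact h3 hab
  have e3 : a ≠ d := by rintro rfl; exact h1 hcd.symm
  have inj : Function.Injective ![a, b, c, d] := by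
    intro i j hij
    fin_cases i <;> fin_cases j <;>
      simp_all [hab.ne, hbc.ne, hcd.ne, hab.ne', hbc.ne', hcd.ne', e1.symm, e2.symm, e3.symm]
  refine hP4.false ⟨⟨![a, b, c, d], inj⟩, ?_⟩
  intro i j
  fin_cases i <;> fin_cases j <;>
    simp [pathGraph_adj, hab, hbc, hcd, hab.symm, hbc.symm, hcd.symm, h1, h2, h3, G.adj_comm c a,
      G.adj_comm d b, G.adj_comm d a]

theorem no_claw {V : Type} {G : SimpleGraph V} (hclaw : RFree G claw) {x a b c : V}
    (ha : G.Adj x a) (hb : G.Adj x b) (hc : G.Adj x c) (e1 : a ≠ b) (e2 : a ≠ c) (e3 : b ≠ c) :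
    G.Adj a b ∨ G.Adj a c ∨ G.Adj b c := by
  by_contra! h
  obtain ⟨h1, h2, h3⟩ := h
  have inj : Function.Injective ![x, a, b, c] := by
    intro i j hij
    fin_cases i <;> fin_cases j <;>
      simp_all [ha.ne, hb.ne, hc.ne, ha.ne', hb.ne', hc.ne', e1.symm, e2.symm, e3.symm]
  refine hclaw.false ⟨⟨![x, a, b, c], inj⟩, ?_⟩
  intro i j
  fin_cases i <;> fin_cases j <;>
    simp [claw, ha, hb, hc, ha.symm, hb.symm, hc.symm, h1, h2, h3, G.adj_comm b a,
      G.adj_comm c b, G.adj_comm c a]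

theorem CycList.hasCycle {V : Type} {G : SimpleGraph V} {u : V} {t : List V}
    (h : CycList G u t) (ht : 2 ≤ t.length) : HasCycleLength G (t.length + 1) := by
  obtain ⟨hn, hc⟩ := h
  have aux : ∀ (x y : V) (W : G.Walk x y), x = u → y = u →
      ∃ c : G.Walk u u, c.support = W.support := by
    rintro x y W rfl rfl
    exact ⟨W, rfl⟩
  obtain ⟨c, hs⟩ := aux _ _ (Walk.ofSupport (u :: t ++ [u]) (by simp) hc) (by simp) (by simp)
  rw [Walk.support_ofSupport] at hs
  have hl : c.length = t.length + 1 := by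
    have := c.length_support
    rw [hs] at this
    simp at this; omega
  refine ⟨u, c, ?_, hl⟩
  rw [Walk.isCycle_iff_isPath_tail_and_le_length]
  refine ⟨?_, by omega⟩
  rw [Walk.isPath_def, Walk.support_tail_of_not_nil, hs]
  · simp [List.nodup_append] at hn ⊢
    grind
  · intro hnil
    rw [Walk.nil_iff_length_eq] at hnil
    omega

theorem CycList.rot {V : Type} {G : SimpleGraph V} {u w : V} {A B : List V}
    (h : CycList G u (A ++ w :: B)) : CycList G w (B ++ u :: A) := by
  obtain ⟨hn, hc⟩ := h
  refine ⟨?_, ?_⟩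
  · refine (List.Perm.nodup_iff ?_).1 hn
    have : (u :: A ++ w :: B).Perm (w :: B ++ u :: A) := List.perm_append_comm
    simpa using this
  · have h1 : List.IsChain G.Adj ((u :: A) ++ w :: (B ++ [u])) := by simpa using hc
    have h2 : List.IsChain G.Adj ((w :: B) ++ u :: (A ++ [w])) := by
      rw [List.isChain_split] at h1 ⊢
      exact ⟨by simpa using h1.2, by simpa using h1.1⟩
    simpa using h2

theorem CycList.rot_mem {V : Type} {G : SimpleGraph V} {u w : V} {t : List V}
    (h : CycList G u t) (hw : w ∈ u :: t) :
    ∃ s, CycList G w s ∧ s.length = t.length ∧ ∀ x, x ∈ w :: s ↔ x ∈ u :: t := by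
  rcases List.mem_cons.1 hw with rfl | hw
  · exact ⟨t, h, rfl, fun _ => Iff.rfl⟩
  · obtain ⟨A, B, rfl⟩ := List.append_of_mem hw
    refine ⟨_, h.rot, by simp; omega, fun x => ?_⟩
    simp; tauto

/-- data at the start of a cyclic list -/
theorem ext_or_not {V : Type} {G : SimpleGraph V} (hclaw : RFree G claw) {u v : V} {t : List V}
    (h : CycList G u t) (hv : v ∉ u :: t) (hvu : G.Adj v u) {a b : V}
    (ha : t.head? = some a) (hb : t.getLast? = some b) (hab : a ≠ b) :
    ExtList G t ∨ (G.Adj u a ∧ G.Adj u b ∧ ¬ G.Adj v a ∧ ¬ G.Adj v b ∧ G.Adj a b) := by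
  obtain ⟨hn, hc⟩ := h
  have hc' := hc
  simp [List.isChain_append, List.isChain_cons, ha, hb] at hc
  obtain ⟨hua, hct, hbu⟩ := hc
  have hav : a ≠ v := by rintro rfl; exact hv (List.mem_cons_of_mem _ (List.mem_of_head? ha))
  have hbv : b ≠ v := by rintro rfl; exact hv (List.mem_cons_of_mem _ (List.mem_of_getLast? hb))
  by_cases h1 : G.Adj v a
  · left
    refine ⟨u, v :: t, ⟨?_, ?_⟩, by simp⟩
    · simp at hn hv ⊢; grind
    · simp [List.isChain_append, List.isChain_cons, List.getLast?_cons, ha, hb, hvu.symm, h1, hct, hbu]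
  by_cases h2 : G.Adj v b
  · left
    refine ⟨v, u :: t, ⟨?_, ?_⟩, by simp⟩
    · simp at hn hv ⊢; grind
    · simp [List.isChain_append, List.isChain_cons, List.getLast?_cons, ha, hb, hvu, h2.symm, hct, hua]
  right
  refine ⟨hua, hbu.symm, h1, h2, ?_⟩
  rcases no_claw hclaw hvu.symm hua hbu.symm hav.symm hbv.symm hab with h | h | h
  · exact absurd h h1
  · exact absurd h h2
  · exact h

theorem two_nbrs {V : Type} {G : SimpleGraph V} (hclaw : RFree G claw)
    (hP4 : RFree G (pathGraph 4)) {u v w : V} {t : List V}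
    (h : CycList G u t) (ht : 2 ≤ t.length) (hv : v ∉ u :: t) (hvu : G.Adj v u)
    (hw : w ∈ t) (hvw : G.Adj v w) : ExtList G t := by
  obtain ⟨A, B, rfl⟩ := List.append_of_mem hw
  have hr := h.rot
  have hvr : v ∉ w :: (B ++ u :: A) := by simp at hv ⊢; tauto
  have hlen : (B ++ u :: A).length = (A ++ w :: B).length := by simp; omega
  have key : ∀ {s : List V}, s.length = (A ++ w :: B).length → ExtList G s →
      ExtList G (A ++ w :: B) := by
    rintro s hs ⟨x, y, h1, h2⟩
    exact ⟨x, y, h1, by omega⟩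
  have hn := h.1
  obtain ⟨a, ha⟩ : ∃ a, (A ++ w :: B).head? = some a := by cases A <;> simp
  obtain ⟨b', hb'⟩ : ∃ a, (A ++ w :: B).getLast? = some a := by
    exact ⟨_, List.getLast?_eq_some_getLast (by simp)⟩
  obtain ⟨b, hb⟩ : ∃ a, (B ++ u :: A).head? = some a := by cases B <;> simp
  obtain ⟨a', ha'⟩ : ∃ a, (B ++ u :: A).getLast? = some a := by
    exact ⟨_, List.getLast?_eq_some_getLast (by simp)⟩
  have hne : ∀ {s : List V} {x y : V}, s.Nodup → 2 ≤ s.length → s.head? = some x →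
      s.getLast? = some y → x ≠ y := by
    intro s x y hs hl hx hy
    rcases s with _ | ⟨p, s⟩
    · simp at hl
    · rcases s.eq_nil_or_concat with rfl | ⟨L, q, rfl⟩
      · simp at hl
      · simp [List.getLast?_cons] at hx hy hs
        grind
  rcases ext_or_not hclaw h hv hvu ha hb' (hne (List.nodup_cons.1 hn).2 ht ha hb') with
    hE | ⟨hua, hub', hva, hvb', hab'⟩
  · exact hE
  rcases ext_or_not hclaw hr hvr hvw hb ha'
    (hne (List.nodup_cons.1 hr.1).2 (by omega) hb ha') with hE | ⟨hwb, hwa', hvb, hva', hba'⟩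
  · exact key hlen hE
  rcases A with _ | ⟨a1, A1⟩
  · simp at ha; subst ha; exact absurd hvw hva
  rcases B with _ | ⟨b1, B1⟩
  · simp at hb; subst hb; exact absurd hvu hvb
  simp only [List.cons_append, List.head?_cons, Option.some.injEq] at ha hb
  subst ha hb
  generalize hA : a1 :: A1 = A at *
  generalize hB : b1 :: B1 = B at *
  have hAh : A.head? = some a1 := by simp [← hA]
  have hBh : B.head? = some b1 := by simp [← hB]
  have hAl : A.getLast? = some a' := by
    rw [← ha', ← hA]; simp [List.getLast?_cons, List.getLast?_append]
  have hBl : B.getLast? = some b' := by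
    rw [← hb', ← hB]; simp [List.getLast?_cons, List.getLast?_append]
  have hcA : List.IsChain G.Adj A := by
    have := h.2; simp [List.isChain_append, List.isChain_cons] at this; tauto
  have hcB : List.IsChain G.Adj B := by
    have := hr.2; simp [List.isChain_append, List.isChain_cons] at this; tauto
  have hcA' : List.IsChain G.Adj A.reverse := by
    rw [List.isChain_reverse]; simpa [G.adj_comm] using hcA
  have c1 : G.Adj w a1 → ExtList G (A ++ w :: B) := by
    intro hwa
    refine ⟨u, v :: w :: (A ++ B), ⟨?_, ?_⟩, by simp; omega⟩
    · simp [List.nodup_append] at hn hv ⊢; grind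
    · simp [List.isChain_append, List.isChain_cons, List.getLast?_cons, hAh, hBh, hAl, hBl, hcA,
        hcB, hvu.symm, hvw, hwa, hba'.symm, hub'.symm]
  have c2 : G.Adj u b1 → ExtList G (A ++ w :: B) := by
    intro hub
    refine ⟨w, v :: u :: (B ++ A), ⟨?_, ?_⟩, by simp; omega⟩
    · simp [List.nodup_append] at hn hv ⊢; grind
    · simp [List.isChain_append, List.isChain_cons, List.getLast?_cons, hAh, hBh, hAl, hBl, hcA,
        hcB, hvu, hvw.symm, hub, hab'.symm, hwa'.symm]
  have c3 : G.Adj a1 b1 → ExtList G (A ++ w :: B) := by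
    intro hub
    refine ⟨u, v :: w :: (A.reverse ++ B), ⟨?_, ?_⟩, by simp; omega⟩
    · simp [List.nodup_append] at hn hv ⊢; grind
    · simp [List.isChain_append, List.isChain_cons, List.getLast?_cons, hAh, hBh, hAl, hBl, hcA',
        hcB, hvu.symm, hvw, hub, hwa', hub'.symm]
  by_cases huw : G.Adj u w
  · rcases no_P4 hP4 hua.symm huw hwb with h | h | h
    · exact c1 h.symm
    · exact c2 h
    · exact c3 h
  · rcases no_P4 hP4 hua.symm hvu.symm hvw with h | h | h
    · exact absurd h.symm hva
    · exact absurd h huw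
    · exact c1 h.symm

theorem crossing_s10 {V : Type} {G : SimpleGraph V} (hG : G.Connected) (S : Set V) {p q : V}
    (hp : p ∈ S) (hq : q ∉ S) : ∃ x y, x ∈ S ∧ y ∉ S ∧ G.Adj x y := by
  obtain ⟨W⟩ := hG.preconnected p q
  obtain ⟨d, -, h1, h2⟩ := W.exists_boundary_dart S hp hq
  exact ⟨_, _, h1, h2, d.adj⟩

theorem extend {V : Type} [Fintype V] {G : SimpleGraph V} (hG : G.Connected)
    (h2 : ∀ v : V, (G.induce {u : V | u ≠ v}).Connected) (hclaw : RFree G claw)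
    (hP4 : RFree G (pathGraph 4)) {u : V} {t : List V}
    (h : CycList G u t) (ht : 2 ≤ t.length) (hlt : t.length + 1 < Fintype.card V) :
    ExtList G t := by
  classical
  by_contra hE
  have uniq : ∀ v, v ∉ u :: t → ∀ x ∈ u :: t, ∀ y ∈ u :: t, G.Adj v x → G.Adj v y → x = y := by
    intro v hv x hx y hy hvx hvy
    by_contra hxy
    obtain ⟨s, hs, hl, hm⟩ := h.rot_mem hx
    have hys : y ∈ s := by
      have := (hm y).2 hy
      simp at this
      rcases this with rfl | h
      · exact absurd rfl hxy
      · exact h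
    obtain ⟨p, q, h3, h4⟩ := two_nbrs hclaw hP4 hs (by omega) (by rwa [hm]) hvx hys hvy
    exact hE ⟨p, q, h3, by omega⟩
  obtain ⟨q, hq⟩ : ∃ q, q ∉ u :: t := by
    by_contra! hall
    have : Finset.univ ⊆ (u :: t).toFinset := fun x _ => by simpa using hall x
    have h1 := Finset.card_le_card this
    have h2 := (u :: t).toFinset_card_le
    rw [Finset.card_univ] at h1
    simp only [List.length_cons] at h2
    omega
  obtain ⟨z, v, hz, hv, hzv⟩ := crossing_s10 hG {x | x ∈ u :: t} (p := u) (by simp) hq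
  simp only [Set.mem_setOf_eq] at hz hv
  obtain ⟨s, hs, hl, hm⟩ := h.rot_mem hz
  -- two distinct cycle neighbours of `z`
  obtain ⟨a, b, ha, hb, hab, hza, hzb⟩ : ∃ a b, a ∈ s ∧ b ∈ s ∧ a ≠ b ∧ G.Adj z a ∧ G.Adj z b := by
    rcases s with _ | ⟨a, s⟩
    · simp at hl; omega
    rcases s.eq_nil_or_concat with rfl | ⟨L, b, rfl⟩
    · simp at hl; omega
    refine ⟨a, b, by simp, by simp, ?_, ?_, ?_⟩
    · have := hs.1; simp at this; grind
    · have := hs.2; simp [List.isChain_cons] at this; tauto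
    · have := hs.2; simp [List.isChain_append, List.isChain_cons] at this
      exact this.2.2.2.1.symm
  have hza' : a ≠ z := hza.ne'
  have ha' := (hm a).1 (List.mem_cons_of_mem _ ha)
  have hb' := (hm b).1 (List.mem_cons_of_mem _ hb)
  have hvz : v ≠ z := by rintro rfl; exact hv hz
  obtain ⟨⟨x, hx⟩, ⟨y, hy⟩, ⟨hxt, hxz⟩, hyD, hxy⟩ := crossing_s10 (h2 z)
    {x | x.1 ∉ u :: t ∧ G.Adj x.1 z} (p := ⟨v, hvz⟩) (q := ⟨a, hza'⟩) ⟨hv, hzv.symm⟩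
    (by simp only [Set.mem_setOf_eq, not_and]; intro h; exact absurd ha' h)
  simp only [Set.mem_setOf_eq, not_and] at hx hy hyD hxt hxz
  replace hxy : G.Adj x y := hxy
  by_cases hyt : y ∈ u :: t
  · exact hy (uniq x hxt y hyt z hz hxy hxz)
  have hyz := hyD hyt
  have fin : ∀ c, c ∈ u :: t → G.Adj z c → ¬ G.Adj y c → False := by
    intro c hc hzc hyc
    rcases no_P4 hP4 hzc.symm hxz.symm hxy with h | h | h
    · exact hzc.ne (uniq x hxt z hz c hc hxz h.symm)
    · exact hyz h.symm
    · exact hyc h.symm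
  by_cases hya : G.Adj y a
  · refine fin b hb' hzb fun hyb => hab (uniq y hyt a ha' b hb' hya hyb)
  · exact fin a ha' hza hya

theorem twoConn_connected {V : Type} [Fintype V] {G : SimpleGraph V} (h2 : TwoConnected G) :
    G.Connected := by
  classical
  obtain ⟨hc, h2⟩ := h2
  haveI : Nonempty V := Fintype.card_pos_iff.1 (by omega)
  refine ⟨fun a b => ?_⟩
  obtain ⟨c, hc⟩ : ∃ c, c ∉ ({a, b} : Finset V) := by
    by_contra! hall
    have h1 := Finset.card_le_card (fun x _ => hall x : Finset.univ ⊆ ({a, b} : Finset V))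
    have := Finset.card_le_two (a := a) (b := b)
    rw [Finset.card_univ] at h1; omega
  simp at hc
  have := (h2 c).preconnected ⟨a, Ne.symm hc.1⟩ ⟨b, Ne.symm hc.2⟩
  exact this.map (Embedding.induce _).toHom

theorem exists_triangle {V : Type} [Fintype V] (G : SimpleGraph V)
    [DecidableRel G.Adj] (h2 : TwoConnected G) (hnc : ¬ IsCycleGraph G)
    (hclaw : RFree G claw) : ∃ x a b, CycList G x [a, b] := by
  classical
  have hG := twoConn_connected h2
  obtain ⟨x, hx⟩ : ∃ x, G.degree x ≠ 2 := by
    by_contra! hall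
    exact hnc ⟨hG, hall⟩
  have hdeg : 3 ≤ G.degree x := by
    by_contra hlt
    have h1 : G.degree x ≤ 1 := by omega
    rw [← G.card_neighborFinset_eq_degree, Finset.card_le_one_iff] at h1
    haveI : Nontrivial V := Fintype.one_lt_card_iff_nontrivial.1 (by have := h2.1; omega)
    obtain ⟨y, hy⟩ := exists_ne x
    obtain ⟨x', n, rfl, -, hxn⟩ := crossing_s10 hG {x} (p := x) (q := y) rfl hy
    obtain ⟨c, hc⟩ : ∃ c, c ∉ ({x', n} : Finset V) := by
      by_contra! hall
      have h1 := Finset.card_le_card (fun x _ => hall x : Finset.univ ⊆ ({x', n} : Finset V))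
      have := Finset.card_le_two (a := x') (b := n)
      have := h2.1
      rw [Finset.card_univ] at h1; omega
    simp at hc
    obtain ⟨p, q, hp, hq, hpq⟩ := crossing_s10 (h2.2 n) {⟨x', hxn.ne⟩} (p := ⟨x', hxn.ne⟩)
      (q := ⟨c, hc.2⟩) rfl (by simpa using hc.1)
    simp only [Set.mem_singleton_iff] at hp
    subst hp
    have hpq' : G.Adj x' q.1 := hpq
    exact q.2 (h1 (by simpa using hpq') (by simpa using hxn))
  rw [← G.card_neighborFinset_eq_degree] at hdeg
  obtain ⟨a, b, c, ha, hb, hc, hab, hac, hbc⟩ := Finset.two_lt_card_iff.1 hdeg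
  simp only [mem_neighborFinset] at ha hb hc
  have mk : ∀ p q, G.Adj x p → G.Adj x q → G.Adj p q → ∃ x a b, CycList G x [a, b] := by
    intro p q hp hq hpq
    refine ⟨x, p, q, ?_, ?_⟩
    · simp [hp.ne, hq.ne, hpq.ne]
    · simp [hp, hq.symm, hpq]
  rcases no_claw hclaw ha hb hc hab hac hbc with h | h | h
  · exact mk _ _ ha hb h
  · exact mk _ _ ha hc h
  · exact mk _ _ hb hc h

theorem pancyclic_of_claw_P4_free {V : Type} [Fintype V] (G : SimpleGraph V)
    [DecidableRel G.Adj] (h2 : TwoConnected G) (hnc : ¬ IsCycleGraph G)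
    (hclaw : RFree G claw) (hP4 : RFree G (pathGraph 4)) :
    IsPancyclic G := by
  have main : ∀ k : ℕ, 3 ≤ k → k ≤ Fintype.card V →
      ∃ u t, CycList G u t ∧ t.length + 1 = k := by
    intro k hk
    induction k, hk using Nat.le_induction with
    | base =>
      intro _
      obtain ⟨x, a, b, h⟩ := exists_triangle G h2 hnc hclaw
      exact ⟨x, _, h, rfl⟩
    | succ k hk ih =>
      intro hle
      obtain ⟨u, t, h, hl⟩ := ih (by omega)
      obtain ⟨u', t', h', hl'⟩ := extend (twoConn_connected h2) h2.2 hclaw hP4 h (by omega)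
        (by omega)
      exact ⟨u', t', h', by omega⟩
  intro k hk hle
  obtain ⟨u, t, h, rfl⟩ := main k hk hle
  exact h.hasCycle (by omega)
end
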